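/- Let Ξ ⊆ Ω be of the form Ξ = { ω ∈ Ω : (ω, ⟨ω⟩) ∈ Ξ̄ } for a set Ξ̄ ⊆ C[0,T]×C[0,T] satisfying condition (A2). Then for every Borel measurable function ξ : C[0,T] → (−∞,∞] which is bounded from below, sup_{Q ∈ M(Ξ)} E_Q[ξ] = sup_{Q̄ ∈ M̄(Ξ̄)} E_{Q̄}[ξ ∘ S̄]. -/

import Mathlib

open MeasureTheory Filter Set Topology
open scoped ENNReal Classical

noncomputable section

namespace PathwiseSuperhedging

/-- The path space `C[0,T]`: continuous functions on `[0,T]` with the sup-norm. -/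
abbrev Path (T : ℝ) := C(Set.Icc (0:ℝ) T, ℝ)

variable (T : ℝ)

instance : MeasurableSpace (Path T) := borel _
instance : BorelSpace (Path T) := ⟨rfl⟩

variable (hT : 0 ≤ T)

/-- time `0` as an element of `[0,T]`. -/
def t0 : Set.Icc (0:ℝ) T := ⟨0, le_refl 0, hT⟩

/-- clamp a real time into `[0,T]`. -/
def clamp (t : ℝ) : Set.Icc (0:ℝ) T := Set.projIcc 0 T hT t

/-- evaluation of a path at a (clamped) real time. -/
def ev (ω : Path T) (t : ℝ) : ℝ := ω (clamp T hT t)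

/-- The stopping times `σ^m_k`:  `σ^m_0 = 0` and
`σ^m_{k+1} = inf { t ≥ σ^m_k : |S_t - S_{σ^m_k}| ≥ 2^{-m} }` (equal to `T+1` if no such
time `t ≤ T` exists). -/
def sig (m : ℕ) : ℕ → Path T → ℝ
  | 0 => fun _ => 0
  | k + 1 => fun ω =>
      sInf ({t : ℝ | sig m k ω ≤ t ∧ t ≤ T ∧
        (2:ℝ) ^ (-(m:ℤ)) ≤ |ev T hT ω t - ev T hT ω (sig m k ω)|} ∪ {T + 1})

/-- The discretized integral `𝕊^m_t = ∑_k S_{σ^m_k} (S_{σ^m_{k+1} ∧ t} - S_{σ^m_k ∧ t})`. -/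
def Sm (m : ℕ) (t : ℝ) (ω : Path T) : ℝ :=
  ∑' k : ℕ, ev T hT ω (sig T hT m k ω) *
    (ev T hT ω (min (sig T hT m (k + 1) ω) t) - ev T hT ω (min (sig T hT m k ω) t))

/-- The pathwise integral `𝕊_t = liminf_m 𝕊^m_t`. -/
def SS (t : ℝ) (ω : Path T) : ℝ := Filter.liminf (fun m => Sm T hT m t ω) Filter.atTop

/-- The candidate quadratic variation `S_t² - S_0² - 2 𝕊_t`. -/
def qvRaw (ω : Path T) (t : ℝ) : ℝ := (ev T hT ω t) ^ 2 - (ev T hT ω 0) ^ 2 - 2 * SS T hT t ω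

/-- The set `Ω` of paths for which `𝕊^m → 𝕊` uniformly and
`t ↦ S_t² - S_0² - 2𝕊_t` is nondecreasing. -/
def BigOmega : Set (Path T) :=
  {ω | TendstoUniformly (fun m (t : Set.Icc (0:ℝ) T) => Sm T hT m (t : ℝ) ω)
        (fun t => SS T hT (t : ℝ) ω) Filter.atTop ∧
      MonotoneOn (qvRaw T hT ω) (Set.Icc (0:ℝ) T)}

/-- The pathwise quadratic variation `⟨ω⟩`, as an element of `C[0,T]`; it equals
`S² - S_0² - 2𝕊` for `ω ∈ Ω` (this function being continuous there) and `0` otherwise. -/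
def qv (ω : Path T) : Path T :=
  if h : ω ∈ BigOmega T hT ∧ Continuous fun t : Set.Icc (0:ℝ) T => qvRaw T hT ω (t : ℝ)
  then ⟨fun t => qvRaw T hT ω (t : ℝ), h.2⟩ else 0

/-- The raw filtration `F_t = σ(S_s : s ≤ t)` generated by the canonical process. -/
def Fraw (t : ℝ) : MeasurableSpace (Path T) :=
  ⨆ (s : Set.Icc (0:ℝ) T) (_ : (s : ℝ) ≤ t),
    MeasurableSpace.comap (fun ω : Path T => ω s) inferInstance

/-- The right-continuous filtration `F_{t+} = ⋂_{s > t} F_{s ∧ T}`. -/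
def Fplus (t : ℝ) : MeasurableSpace (Path T) :=
  ⨅ (s : ℝ) (_ : t < s), Fraw T (min s T)

/-- `τ` is a stopping time for the raw filtration `𝔽`. -/
def IsStopRaw (τ : Path T → ℝ) : Prop :=
  ∀ t ∈ Set.Icc (0:ℝ) T, MeasurableSet[Fraw T t] {ω | τ ω ≤ t}

/-- `τ` is a stopping time for the right-continuous filtration `𝔽₊`. -/
def IsStopPlus (τ : Path T → ℝ) : Prop :=
  ∀ t ∈ Set.Icc (0:ℝ) T, MeasurableSet[Fplus T t] {ω | τ ω ≤ t}

/-- `f` is measurable with respect to the σ-field `F_{τ+}`. -/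
def MeasAtStopPlus (τ f : Path T → ℝ) : Prop :=
  ∀ B : Set ℝ, MeasurableSet B → ∀ t ∈ Set.Icc (0:ℝ) T,
    MeasurableSet[Fplus T t] (f ⁻¹' B ∩ {ω | τ ω ≤ t})

/-- The set `ℋ` of simple trading strategies `H = ∑_{l=1}^L h_l 1_{(τ_l, τ_{l+1}]}`
with `𝔽₊`-stopping times `0 ≤ τ_1 ≤ ⋯ ≤ τ_{L+1} ≤ T` and bounded `F_{τ_l+}`-measurable
coefficients `h_l`. -/
structure SimpleStrategy where
  L : ℕ
  τ : Fin (L + 1) → Path T → ℝ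
  coeff : Fin L → Path T → ℝ
  τ_nonneg : ∀ ω, 0 ≤ τ 0 ω
  τ_mono : ∀ (l : Fin L) (ω), τ l.castSucc ω ≤ τ l.succ ω
  τ_le : ∀ ω, τ (Fin.last L) ω ≤ T
  τ_stop : ∀ l, IsStopPlus T (τ l)
  coeff_bdd : ∀ l, ∃ C : ℝ, ∀ ω, |coeff l ω| ≤ C
  coeff_meas : ∀ l : Fin L, MeasAtStopPlus T (τ l.castSucc) (coeff l)

/-- The pathwise stochastic integral `(H · X)_t(ω)` of a simple strategy against a process. -/
def integ (H : SimpleStrategy T) (X : ℝ → Path T → ℝ) (t : ℝ) (ω : Path T) : ℝ :=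
  ∑ l : Fin H.L, H.coeff l ω *
    (X (min (H.τ l.succ ω) t) ω - X (min (H.τ l.castSucc ω) t) ω)

/-- The canonical process `S_t(ω) = ω(t)`. -/
def Sproc (t : ℝ) (ω : Path T) : ℝ := ev T hT ω t

/-- `X` is a `Q`-`𝔽`-martingale (on the time interval `[0,T]`). -/
def IsMart (Q : Measure (Path T)) (X : ℝ → Path T → ℝ) : Prop :=
  (∀ t ∈ Set.Icc (0:ℝ) T, Integrable (X t) Q) ∧
  ∀ s t : ℝ, s ∈ Set.Icc (0:ℝ) T → t ∈ Set.Icc (0:ℝ) T → s ≤ t →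
    ∀ A : Set (Path T), MeasurableSet[Fraw T s] A →
      ∫ ω in A, X t ω ∂Q = ∫ ω in A, X s ω ∂Q

/-- `X` is a `Q`-`𝔽`-local martingale: there are `𝔽`-stopping times increasing `Q`-a.s.
to `∞` such that each stopped process is a `Q`-`𝔽`-martingale. -/
def IsLocalMart (Q : Measure (Path T)) (X : ℝ → Path T → ℝ) : Prop :=
  ∃ τ : ℕ → Path T → ℝ,
    (∀ m, IsStopRaw T (τ m)) ∧
    (∀ᵐ ω ∂Q, Monotone (fun m => τ m ω) ∧ Tendsto (fun m => τ m ω) atTop atTop) ∧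
    (∀ m, IsMart T Q (fun t ω => X (min (τ m ω) t) ω))

/-- The set `M(Ξ)` of local martingale measures concentrated on `Ξ`. -/
def MSet (Ξ : Set (Path T)) : Set (Measure (Path T)) :=
  {Q | IsProbabilityMeasure Q ∧ IsLocalMart T Q (Sproc T hT) ∧ Q Ξ = 1}

/-- The set `M_Z(Ξ)` of local martingale measures concentrated on `Ξ` with `E_Q[Z] < ∞`. -/
def MZSet (Ξ : Set (Path T)) (Z : Path T → ℝ≥0∞) : Set (Measure (Path T)) :=
  {Q | IsProbabilityMeasure Q ∧ IsLocalMart T Q (Sproc T hT) ∧ Q Ξ = 1 ∧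
       ∫⁻ ω, Z ω ∂Q ≠ ⊤}

/-- The stopped path `ω^t(s) = ω(t ∧ s)`. -/
def stopPath (ω : Path T) (t : Set.Icc (0:ℝ) T) : Path T :=
  ⟨fun s => ω ⟨min t.1 s.1, le_min t.2.1 s.2.1, (min_le_left _ _).trans t.2.2⟩,
    ω.continuous.comp ((continuous_const.min continuous_subtype_val).subtype_mk _)⟩

/-- Assumption A on the prediction set `Ξ` and its lift `Ξ̄`. -/
structure AssumptionA (Ξ : Set (Path T)) (Xibar : Set (Path T × Path T)) : Prop where
  xi_nonempty : Ξ.Nonempty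
  xibar_nonempty : Xibar.Nonempty
  xi_eq : Ξ = {ω ∈ BigOmega T hT | (ω, qv T hT ω) ∈ Xibar}
  A1 : ∃ K : ℕ → Set (Path T × Path T), (∀ n, IsCompact (K n)) ∧ Xibar = ⋃ n, K n
  A2 : ∀ p ∈ Xibar, p.2 (t0 T hT) = 0 ∧ Monotone p.2
  A3 : ∀ p ∈ Xibar, ∀ t : Set.Icc (0:ℝ) T, (stopPath T p.1 t, stopPath T p.2 t) ∈ Xibar

/-! ### The enlarged space -/

/-- The enlarged space `Ω̄ = C[0,T] × C[0,T]`. -/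
abbrev PathPair (T : ℝ) := Path T × Path T

/-- The embedding `ψ(ω) = (ω, ⟨ω⟩)`. -/
def psiMap (ω : Path T) : PathPair T := (ω, qv T hT ω)

/-- The diagonal set `Δ̄ = ψ(Ω)`. -/
def Delta : Set (PathPair T) := psiMap T hT '' BigOmega T hT

/-- The first canonical process `S̄_t(ω,ν) = ω(t)` on the enlarged space. -/
def SbarProc (t : ℝ) (p : PathPair T) : ℝ := ev T hT p.1 t

/-- The second canonical process `V̄_t(ω,ν) = ν(t)` on the enlarged space. -/
def VbarProc (t : ℝ) (p : PathPair T) : ℝ := ev T hT p.2 t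

/-- The process `𝕊̄ = (S̄² - S̄_0² - V̄)/2` on the enlarged space. -/
def SSbarProc (t : ℝ) (p : PathPair T) : ℝ :=
  ((ev T hT p.1 t) ^ 2 - (ev T hT p.1 0) ^ 2 - ev T hT p.2 t) / 2

/-- The raw filtration `F̄_t = σ(S̄_s, V̄_s : s ≤ t)` on the enlarged space. -/
def FbarRaw (t : ℝ) : MeasurableSpace (PathPair T) :=
  ⨆ (s : Set.Icc (0:ℝ) T) (_ : (s : ℝ) ≤ t),
    MeasurableSpace.comap (fun p : PathPair T => (p.1 s, p.2 s)) inferInstance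

/-- The right-continuous filtration `F̄_{t+} = ⋂_{s>t} F̄_{s ∧ T}` on the enlarged space. -/
def FbarPlus (t : ℝ) : MeasurableSpace (PathPair T) :=
  ⨅ (s : ℝ) (_ : t < s), FbarRaw T (min s T)

/-- The σ-field generated by all subsets of `Δ̄ᶜ`. -/
def nullDelta : MeasurableSpace (PathPair T) :=
  MeasurableSpace.generateFrom {N : Set (PathPair T) | N ⊆ (Delta T hT)ᶜ}

/-- The `Δ̄`-augmented raw filtration `F̄^Δ_t`. -/
def FbarDelta (t : ℝ) : MeasurableSpace (PathPair T) := FbarRaw T t ⊔ nullDelta T hT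

/-- The `Δ̄`-augmented right-continuous filtration `F̄^Δ_{t+}`. -/
def FbarDeltaPlus (t : ℝ) : MeasurableSpace (PathPair T) := FbarPlus T t ⊔ nullDelta T hT

/-- `τ` is a stopping time for the raw filtration `𝔽̄` on the enlarged space. -/
def IsStopBarRaw (τ : PathPair T → ℝ) : Prop :=
  ∀ t ∈ Set.Icc (0:ℝ) T, MeasurableSet[FbarRaw T t] {p | τ p ≤ t}

/-- `τ` is a stopping time for the filtration `𝔽̄₊^Δ`. -/
def IsStopBarDeltaPlus (τ : PathPair T → ℝ) : Prop :=
  ∀ t ∈ Set.Icc (0:ℝ) T, MeasurableSet[FbarDeltaPlus T hT t] {p | τ p ≤ t}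

/-- `f` is measurable with respect to `F̄^Δ_{τ+}`. -/
def MeasAtStopBarDeltaPlus (τ f : PathPair T → ℝ) : Prop :=
  ∀ B : Set ℝ, MeasurableSet B → ∀ t ∈ Set.Icc (0:ℝ) T,
    MeasurableSet[FbarDeltaPlus T hT t] (f ⁻¹' B ∩ {p | τ p ≤ t})

/-- The set `ℋ̄` of simple strategies on the enlarged space. -/
structure SimpleStrategyBar where
  L : ℕ
  τ : Fin (L + 1) → PathPair T → ℝ
  coeff : Fin L → PathPair T → ℝ
  τ_nonneg : ∀ p, 0 ≤ τ 0 p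
  τ_mono : ∀ (l : Fin L) (p), τ l.castSucc p ≤ τ l.succ p
  τ_le : ∀ p, τ (Fin.last L) p ≤ T
  τ_stop : ∀ l, IsStopBarDeltaPlus T hT (τ l)
  coeff_bdd : ∀ l, ∃ C : ℝ, ∀ p, |coeff l p| ≤ C
  coeff_meas : ∀ l : Fin L, MeasAtStopBarDeltaPlus T hT (τ l.castSucc) (coeff l)

/-- The pathwise stochastic integral on the enlarged space. -/
def integBar (H : SimpleStrategyBar T hT) (X : ℝ → PathPair T → ℝ) (t : ℝ)
    (p : PathPair T) : ℝ :=
  ∑ l : Fin H.L, H.coeff l p *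
    (X (min (H.τ l.succ p) t) p - X (min (H.τ l.castSucc p) t) p)

/-- `X` is a `Q̄`-`𝔽̄`-martingale on the enlarged space. -/
def IsMartBar (Q : Measure (PathPair T)) (X : ℝ → PathPair T → ℝ) : Prop :=
  (∀ t ∈ Set.Icc (0:ℝ) T, Integrable (X t) Q) ∧
  ∀ s t : ℝ, s ∈ Set.Icc (0:ℝ) T → t ∈ Set.Icc (0:ℝ) T → s ≤ t →
    ∀ A : Set (PathPair T), MeasurableSet[FbarRaw T s] A →
      ∫ p in A, X t p ∂Q = ∫ p in A, X s p ∂Q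

/-- `X` is a `Q̄`-`𝔽̄`-local martingale on the enlarged space. -/
def IsLocalMartBar (Q : Measure (PathPair T)) (X : ℝ → PathPair T → ℝ) : Prop :=
  ∃ τ : ℕ → PathPair T → ℝ,
    (∀ m, IsStopBarRaw T (τ m)) ∧
    (∀ᵐ p ∂Q, Monotone (fun m => τ m p) ∧ Tendsto (fun m => τ m p) atTop atTop) ∧
    (∀ m, IsMartBar T Q (fun t p => X (min (τ m p) t) p))

/-- The set `M̄(Ξ̄)` of measures on the enlarged space under which `S̄` and `𝕊̄` are local
martingales and which are concentrated on `Ξ̄`. -/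
def MbarSet (Xibar : Set (PathPair T)) : Set (Measure (PathPair T)) :=
  {Q | IsProbabilityMeasure Q ∧ IsLocalMartBar T Q (SbarProc T hT) ∧
       IsLocalMartBar T Q (SSbarProc T hT) ∧ Q Xibar = 1}

/-- The set `M̄_{Z̄}(Ξ̄)`. -/
def MbarZSet (Xibar : Set (PathPair T)) (Zbar : PathPair T → ℝ≥0∞) :
    Set (Measure (PathPair T)) :=
  {Q | IsProbabilityMeasure Q ∧ IsLocalMartBar T Q (SbarProc T hT) ∧
       IsLocalMartBar T Q (SSbarProc T hT) ∧ Q Xibar = 1 ∧ ∫⁻ p, Zbar p ∂Q ≠ ⊤}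

/-! ### Expectations and superhedging functionals -/

/-- The positive part of an extended real number, as an element of `[0,∞]`. -/
def erealPos (x : EReal) : ℝ≥0∞ := if x = ⊤ then ⊤ else ENNReal.ofReal x.toReal

/-- The expectation `E_Q[ξ]` of an extended-real-valued random variable, as an
extended real number (positive part minus negative part). -/
def expEReal {α : Type*} [MeasurableSpace α] (Q : Measure α) (ξ : α → EReal) : EReal :=
  ((∫⁻ x, erealPos (ξ x) ∂Q : ℝ≥0∞) : EReal) - ((∫⁻ x, erealPos (-ξ x) ∂Q : ℝ≥0∞) : EReal)

/-- The set of initial capitals `λ` that allow superhedging `ξ` on `Ξ`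
(trading in `S` and `𝕊` with simple strategies, in the liminf sense). -/
def PhiSet (Ξ : Set (Path T)) (ξ : Path T → EReal) : Set ℝ :=
  {lam : ℝ | ∃ H G : ℕ → SimpleStrategy T,
    (∀ n : ℕ, ∀ t ∈ Set.Icc (0:ℝ) T, ∀ ω ∈ Ξ,
      0 ≤ lam + integ T (H n) (Sproc T hT) t ω + integ T (G n) (SS T hT) t ω) ∧
    (∀ ω ∈ Ξ, ξ ω ≤ (lam : EReal) +
      Filter.liminf (fun n =>
        ((integ T (H n) (Sproc T hT) T ω + integ T (G n) (SS T hT) T ω : ℝ) : EReal))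
        Filter.atTop)}

/-- The superhedging price `Φ(ξ)`. -/
def Phi (Ξ : Set (Path T)) (ξ : Path T → EReal) : EReal :=
  sInf ((fun lam : ℝ => (lam : EReal)) '' PhiSet T hT Ξ ξ)

/-- The supremum of the pricing functionals `E_Q[ξ]` over `Q ∈ M(Ξ)`,
for a nonnegative claim `ξ`. -/
def supMart (Ξ : Set (Path T)) (ξ : Path T → ℝ≥0∞) : ℝ≥0∞ :=
  ⨆ Q ∈ MSet T hT Ξ, ∫⁻ ω, ξ ω ∂Q

/-- The liminf-closure `𝒢^Ξ_λ`: the smallest set of functions `C[0,T] → [-∞,∞]`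
containing `λ + (H·S)_T` for admissible simple `H` and closed under countable liminf. -/
inductive GG (Ξ : Set (Path T)) (lam : ℝ) : (Path T → EReal) → Prop
  | base (H : SimpleStrategy T)
      (hadm : ∀ t ∈ Set.Icc (0:ℝ) T, ∀ ω ∈ Ξ, 0 ≤ lam + integ T H (Sproc T hT) t ω) :
      GG Ξ lam (fun ω => ((lam + integ T H (Sproc T hT) T ω : ℝ) : EReal))
  | lim (X : ℕ → Path T → EReal) (h : ∀ n, GG Ξ lam (X n)) :
      GG Ξ lam (fun ω => Filter.liminf (fun n => X n ω) Filter.atTop)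

/-- The superhedging price `Φ^cl(ξ)` defined via the liminf-closure. -/
def PhiCl (Ξ : Set (Path T)) (ξ : Path T → EReal) : EReal :=
  sInf {x : EReal | ∃ lam : ℝ, x = (lam : EReal) ∧
    ∃ Y : Path T → EReal, GG T hT Ξ lam Y ∧ ∀ ω ∈ Ξ, ξ ω ≤ Y ω}


/-- The set of initial capitals allowing superhedging on the enlarged space
(superhedging on `Δ̄ ∩ Ξ̄`). -/
def PhiBarSet (Xibar : Set (PathPair T)) (ξ : PathPair T → EReal) : Set ℝ :=
  {lam : ℝ | ∃ H G : ℕ → SimpleStrategyBar T hT,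
    (∀ n : ℕ, ∀ t ∈ Set.Icc (0:ℝ) T, ∀ p ∈ Delta T hT ∩ Xibar,
      0 ≤ lam + integBar T hT (H n) (SbarProc T hT) t p
            + integBar T hT (G n) (SSbarProc T hT) t p) ∧
    (∀ p ∈ Delta T hT ∩ Xibar, ξ p ≤ (lam : EReal) +
      Filter.liminf (fun n =>
        ((integBar T hT (H n) (SbarProc T hT) T p
          + integBar T hT (G n) (SSbarProc T hT) T p : ℝ) : EReal)) Filter.atTop)}

/-- The superhedging price `Φ̄(ξ̄)` on the enlarged space. -/
def PhiBar (Xibar : Set (PathPair T)) (ξ : PathPair T → EReal) : EReal :=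
  sInf ((fun lam : ℝ => (lam : EReal)) '' PhiBarSet T hT Xibar ξ)

/-- The supremum of pricing functionals over `M̄(Ξ̄)` for a nonnegative claim. -/
def supMartBar (Xibar : Set (PathPair T)) (ξ : PathPair T → ℝ≥0∞) : ℝ≥0∞ :=
  ⨆ Q ∈ MbarSet T hT Xibar, ∫⁻ p, ξ p ∂Q

/-- Assumption B on the prediction set `Ξ`, determined by a growth function `Z̄`
(with values in `[1,∞]`). -/
structure AssumptionB (Ξ : Set (Path T)) (Zbar : PathPair T → ℝ≥0∞) : Prop where
  xi_nonempty : Ξ.Nonempty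
  one_le : ∀ p, 1 ≤ Zbar p
  xi_eq : Ξ = {ω ∈ BigOmega T hT | Zbar (ω, qv T hT ω) ≠ ⊤}
  B1 : ∀ c : ℝ≥0∞, c ≠ ⊤ → IsCompact {p : PathPair T | Zbar p ≤ c}
  B2 : ∀ p : PathPair T, Zbar p ≠ ⊤ → p.2 (t0 T hT) = 0 ∧ Monotone p.2
  B3 : ∀ p : PathPair T, ENNReal.ofReal (‖p.1‖ + ‖p.2‖) ≤ Zbar p

/-- The set of initial capitals allowing `Z`-admissible superhedging of `ξ` on `Ξ`. -/
def PhiZSet (Ξ : Set (Path T)) (Z : Path T → ℝ≥0∞) (ξ : Path T → EReal) : Set ℝ :=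
  {lam : ℝ | ∃ c : ℝ, 0 ≤ c ∧ ∃ H G : ℕ → SimpleStrategy T,
    (∀ n : ℕ, ∀ ω ∈ Ξ,
      -(c * (Z ω).toReal) ≤
        lam + integ T (H n) (Sproc T hT) T ω + integ T (G n) (SS T hT) T ω) ∧
    (∀ ω ∈ Ξ, ξ ω ≤ (lam : EReal) +
      Filter.liminf (fun n =>
        ((integ T (H n) (Sproc T hT) T ω + integ T (G n) (SS T hT) T ω : ℝ) : EReal))
        Filter.atTop)}

/-- The superhedging price `Φ^Z(ξ)`. -/
def PhiZ (Ξ : Set (Path T)) (Z : Path T → ℝ≥0∞) (ξ : Path T → EReal) : EReal :=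
  sInf ((fun lam : ℝ => (lam : EReal)) '' PhiZSet T hT Ξ Z ξ)

/-- The `α`-Hölder norm `‖ω‖_α = |ω(0)| + sup_{s ≠ t} |ω(t) - ω(s)| / |t-s|^α`,
with values in `[0,∞]`. -/
def holderNormE (α : ℝ) (ω : Path T) : ℝ≥0∞ :=
  ENNReal.ofReal |ω (t0 T hT)| +
    ⨆ (s : Set.Icc (0:ℝ) T) (t : Set.Icc (0:ℝ) T) (_ : s ≠ t),
      ENNReal.ofReal (|ω t - ω s| / |t.1 - s.1| ^ α)

/-- The set of Hölder continuous paths `⋃_n { ω : ‖ω‖_{1/n} ≤ n }`. -/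
def CHolder : Set (Path T) :=
  ⋃ n : ℕ, {ω : Path T | 0 < n ∧ holderNormE T hT (1 / n) ω ≤ (n : ℝ≥0∞)}

end PathwiseSuperhedging

namespace PathwiseSuperhedging

structure CA {E : Type*} (F : ℝ → MeasurableSpace E) (T : ℝ) (X : ℝ → E → ℝ) : Prop where
  cont : ∀ ω, Continuous fun t => X t ω
  adapted : ∀ t ∈ Icc (0:ℝ) T, Measurable[F t] (X t)
  neg : ∀ t ≤ 0, ∀ ω, X t ω = X 0 ω

def Stop {E : Type*} (F : ℝ → MeasurableSpace E) (T : ℝ) (τ : E → ℝ) : Prop :=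
  ∀ t ∈ Icc (0:ℝ) T, MeasurableSet[F t] {ω | τ ω ≤ t}

def MeasAt {E : Type*} (F : ℝ → MeasurableSpace E) (T : ℝ) (a h : E → ℝ) : Prop :=
  ∀ u ∈ Icc (0:ℝ) T, Measurable[F u] (fun ω => if a ω ≤ u then h ω else 0)

def Mart {E : Type*} [MeasurableSpace E] (P : Measure E) (F : ℝ → MeasurableSpace E) (T : ℝ)
    (X : ℝ → E → ℝ) : Prop :=
  (∀ t ∈ Icc (0:ℝ) T, Integrable (X t) P) ∧
  ∀ s t : ℝ, s ∈ Icc (0:ℝ) T → t ∈ Icc (0:ℝ) T → s ≤ t →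
    ∀ A : Set E, MeasurableSet[F s] A → ∫ ω in A, X t ω ∂P = ∫ ω in A, X s ω ∂P

def LocMart {E : Type*} [MeasurableSpace E] (P : Measure E) (F : ℝ → MeasurableSpace E) (T : ℝ)
    (X : ℝ → E → ℝ) : Prop :=
  ∃ τ : ℕ → E → ℝ,
    (∀ m, Stop F T (τ m)) ∧
    (∀ᵐ ω ∂P, Monotone (fun m => τ m ω) ∧ Tendsto (fun m => τ m ω) atTop atTop) ∧
    (∀ m, Mart P F T (fun t ω => X (min (τ m ω) t) ω))

def gp (t : ℝ) (N i : ℕ) : ℝ := t * i / (N + 1)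

def gI {E : Type*} (X : ℝ → E → ℝ) (t : ℝ) (N : ℕ) (b : E → ℝ) (ω : E) : ℝ :=
  X 0 ω + ∑ i ∈ Finset.range (N + 1),
    if gp t N i < b ω then X (gp t N (i + 1)) ω - X (gp t N i) ω else 0

lemma tele (f : ℕ → ℝ) (c n : ℕ) :
    ∑ i ∈ Finset.range n, (if i < c then f (i + 1) - f i else 0) = f (min c n) - f 0 := by
  induction n with
  | zero => simp
  | succ n ih =>
    rw [Finset.sum_range_succ, ih]
    split_ifs with h
    · rw [min_eq_right (by omega : n ≤ c), min_eq_right (by omega : n + 1 ≤ c)]; ring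
    · rw [min_eq_left (by omega : c ≤ n), min_eq_left (by omega : c ≤ n + 1)]; ring

lemma gp_zero (t : ℝ) (N : ℕ) : gp t N 0 = 0 := by simp [gp]
lemma gp_last (t : ℝ) (N : ℕ) : gp t N (N + 1) = t := by
  have : ((N:ℝ) + 1) ≠ 0 := by positivity
  simp [gp]; field_simp

lemma gp_mem {t T : ℝ} (ht : t ∈ Icc (0:ℝ) T) {N i : ℕ} (hi : i ≤ N + 1) :
    gp t N i ∈ Icc (0:ℝ) t := by
  have h1 : (0:ℝ) < (N:ℝ) + 1 := by positivity
  have h2 : (i:ℝ) ≤ N + 1 := by exact_mod_cast hi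
  refine ⟨by have := ht.1; unfold gp; positivity, ?_⟩
  unfold gp
  rw [div_le_iff₀ h1]
  exact mul_le_mul_of_nonneg_left h2 ht.1

lemma gp_mono {t : ℝ} (ht : 0 ≤ t) {N i j : ℕ} (h : i ≤ j) : gp t N i ≤ gp t N j := by
  unfold gp
  have : (i:ℝ) ≤ j := by exact_mod_cast h
  gcongr

lemma gI_eq {E : Type*} (X : ℝ → E → ℝ) {t : ℝ} (ht : 0 < t) (N : ℕ) (b : E → ℝ) (ω : E) :
    gI X t N b ω = X (gp t N (min ⌈b ω * (N + 1) / t⌉₊ (N + 1))) ω := by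
  unfold gI
  have h : ∀ i : ℕ, gp t N i < b ω ↔ i < ⌈b ω * (N + 1) / t⌉₊ := by
    intro i
    rw [Nat.lt_ceil, lt_div_iff₀ ht]
    unfold gp
    rw [div_lt_iff₀ (by positivity), mul_comm t]
  simp_rw [h]
  rw [tele (fun i => X (gp t N i) ω), gp_zero]
  ring

lemma gp_ceil_tendsto {t : ℝ} (ht : 0 < t) (b : ℝ) :
    Tendsto (fun N : ℕ => gp t N (min ⌈b * (N + 1) / t⌉₊ (N + 1))) atTop (𝓝 (min (max b 0) t)) := by
  rw [Metric.tendsto_atTop]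
  intro ε hε
  obtain ⟨M, hM⟩ := exists_nat_gt (t / ε)
  refine ⟨M, fun N hN => ?_⟩
  have hN1 : (0:ℝ) < (N:ℝ) + 1 := by positivity
  have hlt : t / (N + 1) < ε := by
    rw [div_lt_iff₀ hN1]
    rw [div_lt_iff₀ hε] at hM
    have : (M:ℝ) ≤ N := by exact_mod_cast hN
    nlinarith
  have e : gp t N (min ⌈b * (N + 1) / t⌉₊ (N + 1))
      = min (t * (⌈b * (N + 1) / t⌉₊ : ℝ) / (N + 1)) t := by
    unfold gp
    rw [Nat.cast_min]
    push_cast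
    rw [mul_min_of_nonneg _ _ ht.le, ← min_div_div_right hN1.le]
    congr 1
    field_simp
  rw [e, Real.dist_eq]
  refine lt_of_le_of_lt ?_ hlt
  have h1 : |t * (⌈b * (N + 1) / t⌉₊ : ℝ) / (N + 1) - max b 0| ≤ t / (N + 1) := by
    rcases le_total b 0 with hb | hb
    · have : ⌈b * (N + 1) / t⌉₊ = 0 := by
        rw [Nat.ceil_eq_zero]
        apply div_nonpos_of_nonpos_of_nonneg _ ht.le
        nlinarith
      rw [this, max_eq_right hb]
      simp
      positivity
    · rw [max_eq_left hb]
      have hx : 0 ≤ b * (N + 1) / t := by positivity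
      have h1 := Nat.le_ceil (b * (N + 1) / t)
      have h2 := Nat.ceil_lt_add_one hx
      rw [div_le_iff₀ ht] at h1
      have h2' : (⌈b * (N + 1) / t⌉₊ : ℝ) * t < b * (N+1) + t := by
        have := mul_lt_mul_of_pos_right h2 ht
        have e : (b * (N + 1) / t + 1) * t = b * (N+1) + t := by field_simp
        linarith
      rw [abs_le]
      have e2 : t * (⌈b * (N + 1) / t⌉₊ : ℝ) / (N + 1) - b
        = (⌈b * (N + 1) / t⌉₊ * t - b * (N+1)) / (N+1) := by field_simp
      rw [e2]
      constructor
      · have : 0 ≤ (⌈b * (N + 1) / t⌉₊ * t - b * (N+1)) / (N+1) := by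
          apply div_nonneg _ hN1.le; linarith
        have : 0 ≤ t / (N+1) := by positivity
        linarith
      · gcongr
        linarith
  exact (abs_min_sub_min_le_max _ _ _ _).trans (max_le h1 (by simp; positivity))

lemma gI_tendsto {E : Type*} {F : ℝ → MeasurableSpace E} {T : ℝ} {X : ℝ → E → ℝ} (hX : CA F T X)
    {t : ℝ} (ht : 0 ≤ t) (b : E → ℝ) (ω : E) :
    Tendsto (fun N => gI X t N b ω) atTop (𝓝 (X (min (b ω) t) ω)) := by
  have e : X (min (b ω) t) ω = X (min (max (b ω) 0) t) ω := by
    rcases le_total (b ω) 0 with h | h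
    · rw [max_eq_right h, min_eq_left (h.trans ht), min_eq_left ht, hX.neg _ h]
    · rw [max_eq_left h]
  rw [e]
  rcases ht.eq_or_lt with h0 | h0
  · subst h0
    have : min (max (b ω) 0) 0 = 0 := by simp
    rw [this]
    have : ∀ N, gI X 0 N b ω = X 0 ω := by
      intro N; simp [gI, gp]
    simp [this]
  · simp_rw [gI_eq X h0]
    exact ((hX.cont ω).tendsto _).comp (gp_ceil_tendsto h0 (b ω))

lemma Stop.lt {E : Type*} {F : ℝ → MeasurableSpace E} {T : ℝ} {b : E → ℝ} (hb : Stop F T b)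
    {u : ℝ} (hu : u ∈ Icc (0:ℝ) T) : MeasurableSet[F u] {ω | u < b ω} := by
  have := (hb u hu).compl
  convert this using 1
  ext; simp

lemma gI_meas {E : Type*} {F : ℝ → MeasurableSpace E} (hF : Monotone F) {T : ℝ} {X : ℝ → E → ℝ}
    (hX : CA F T X) {t : ℝ} (ht : t ∈ Icc (0:ℝ) T) {b : E → ℝ} (hb : Stop F T b) (N : ℕ) :
    Measurable[F t] (gI X t N b) := by
  unfold gI
  have m : ∀ i ≤ N + 1, Measurable[F t] (X (gp t N i)) := fun i hi =>
    (hX.adapted _ ⟨(gp_mem ht hi).1, (gp_mem ht hi).2.trans ht.2⟩).mono (hF (gp_mem ht hi).2) le_rfl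
  refine Measurable.add ?_ (Finset.measurable_fun_sum _ fun i hi => ?_)
  · have := m 0 (by omega); rwa [gp_zero] at this
  · rw [Finset.mem_range] at hi
    refine Measurable.ite ?_ ((m _ (by omega)).sub (m _ (by omega))) measurable_const
    have := gp_mem ht (show i ≤ N + 1 by omega)
    exact hF this.2 _ (hb.lt ⟨this.1, this.2.trans ht.2⟩)

lemma stopped_meas {E : Type*} {F : ℝ → MeasurableSpace E} (hF : Monotone F) {T : ℝ}
    {X : ℝ → E → ℝ}
    (hX : CA F T X) {t : ℝ} (ht : t ∈ Icc (0:ℝ) T) {b : E → ℝ} (hb : Stop F T b) :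
    Measurable[F t] (fun ω => X (min (b ω) t) ω) := by
  refine @measurable_of_tendsto_metrizable E ℝ (F t) _ _ _ _ (fun N => gI X t N b) _
    (fun N => gI_meas hF hX ht hb N) ?_
  rw [tendsto_pi_nhds]
  exact fun ω => gI_tendsto hX ht.1 b ω

lemma CA.stopped {E : Type*} {F : ℝ → MeasurableSpace E} (hF : Monotone F) {T : ℝ}
    {X : ℝ → E → ℝ}
    (hX : CA F T X) {b : E → ℝ} (hb : Stop F T b) :
    CA F T (fun t ω => X (min (b ω) t) ω) where
  cont ω := (hX.cont ω).comp (continuous_const.min continuous_id)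
  adapted t ht := stopped_meas hF hX ht hb
  neg t ht ω := by
    show X (min (b ω) t) ω = X (min (b ω) 0) ω
    rw [hX.neg _ ((min_le_right _ _).trans ht), hX.neg _ (min_le_right _ _)]

lemma mean_zero {E : Type*} [mE : MeasurableSpace E] {P : Measure E} [IsProbabilityMeasure P]
    {F : ℝ → MeasurableSpace E} (hle : ∀ t, F t ≤ mE) {T : ℝ} {X : ℝ → E → ℝ}
    (hM : Mart P F T X) {s t : ℝ} (hs : s ∈ Icc (0:ℝ) T) (ht : t ∈ Icc (0:ℝ) T) (hst : s ≤ t)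
    {g : E → ℝ} (hg : Measurable[F s] g) {C : ℝ} (hC : ∀ᵐ ω ∂P, |g ω| ≤ C) :
    Integrable (fun ω => g ω * (X t ω - X s ω)) P ∧ ∫ ω, g ω * (X t ω - X s ω) ∂P = 0 := by
  have hY : Integrable (fun ω => X t ω - X s ω) P := (hM.1 t ht).sub (hM.1 s hs)
  have hint : Integrable (fun ω => g ω * (X t ω - X s ω)) P := by
    refine hY.bdd_mul (c := C) (hg.mono (hle s) le_rfl).aestronglyMeasurable ?_
    simpa using hC
  refine ⟨hint, ?_⟩
  have h0 : (fun _ => (0:ℝ)) =ᵐ[P] P[(fun ω => X t ω - X s ω) | F s] := by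
    refine ae_eq_condExp_of_forall_setIntegral_eq (hle s) hY (fun _ _ _ => by simp) ?_
      (by exact aestronglyMeasurable_const)
    intro A hA _
    rw [integral_sub (hM.1 t ht).integrableOn (hM.1 s hs).integrableOn,
      hM.2 s t hs ht hst A hA]
    simp
  have h1 := condExp_stronglyMeasurable_mul_of_bound (μ := P) (hle s) (hg.stronglyMeasurable) hY C
    (by simpa using hC)
  have h2 : ∫ ω, g ω * (X t ω - X s ω) ∂P
      = ∫ ω, (P[(g * fun ω => X t ω - X s ω) | F s]) ω ∂P := by
    rw [integral_condExp (hle s)]; rfl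
  rw [h2, integral_congr_ae h1]
  rw [show (0:ℝ) = ∫ ω, (0:ℝ) ∂P by simp]
  refine integral_congr_ae ?_
  filter_upwards [h0] with ω hω
  simp [← hω]

lemma grid_mean {E : Type*} [mE : MeasurableSpace E] {P : Measure E} [IsProbabilityMeasure P]
    {F : ℝ → MeasurableSpace E} (hle : ∀ t, F t ≤ mE) {T : ℝ} {X : ℝ → E → ℝ}
    (hM : Mart P F T X) {t : ℝ} (ht : t ∈ Icc (0:ℝ) T) {a b : E → ℝ}
    (hb : Stop F T b) (hab : ∀ ω, a ω ≤ b ω) (N : ℕ) {h : E → ℝ}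
    (hh : ∀ i < N + 1, Measurable[F (gp t N i)] (fun ω => if a ω ≤ gp t N i then h ω else 0))
    {C : ℝ} (hC0 : 0 ≤ C) (hC : ∀ᵐ ω ∂P, |h ω| ≤ C) :
    ∫ ω, h ω * (gI X t N b ω - gI X t N a ω) ∂P = 0 := by
  have e : ∀ ω, h ω * (gI X t N b ω - gI X t N a ω) = ∑ i ∈ Finset.range (N + 1),
      ((if a ω ≤ gp t N i then h ω else 0) * (if gp t N i < b ω then 1 else 0)) *
        (X (gp t N (i + 1)) ω - X (gp t N i) ω) := by
    intro ω
    unfold gI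
    rw [add_sub_add_left_eq_sub, ← Finset.sum_sub_distrib, Finset.mul_sum]
    refine Finset.sum_congr rfl fun i _ => ?_
    have := hab ω
    by_cases h1 : a ω ≤ gp t N i
    · by_cases h2 : gp t N i < b ω
      · simp [h1, h2, not_lt.mpr h1]
      · simp [h2, not_lt.mpr h1]
    · have h2 : gp t N i < b ω := by push Not at h1; linarith
      push Not at h1
      simp [h1, h2, not_le.mpr h1]
  simp_rw [e]
  have key : ∀ i ∈ Finset.range (N + 1), _ := fun i hi => by
    rw [Finset.mem_range] at hi
    have m1 := gp_mem ht (show i ≤ N + 1 by omega)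
    have m2 := gp_mem ht (show i + 1 ≤ N + 1 by omega)
    refine mean_zero (P := P) hle hM (s := gp t N i) (t := gp t N (i + 1))
      ⟨m1.1, m1.2.trans ht.2⟩ ⟨m2.1, m2.2.trans ht.2⟩ (gp_mono ht.1 (by omega))
      (g := fun ω => (if a ω ≤ gp t N i then h ω else 0) * (if gp t N i < b ω then 1 else 0))
      ((hh i hi).mul (Measurable.ite (hb.lt ⟨m1.1, m1.2.trans ht.2⟩) measurable_const
        measurable_const)) (C := C) ?_
    filter_upwards [hC] with ω hω
    split_ifs <;> simp [hω, hC0]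
  rw [integral_finsetSum _ fun i hi => (key i hi).1]
  exact Finset.sum_eq_zero fun i hi => (key i hi).2

lemma gI_integrable {E : Type*} [mE : MeasurableSpace E] {P : Measure E} [IsProbabilityMeasure P]
    {F : ℝ → MeasurableSpace E} (hle : ∀ t, F t ≤ mE) {T : ℝ} {X : ℝ → E → ℝ}
    (hM : Mart P F T X) {t : ℝ} (ht : t ∈ Icc (0:ℝ) T) {b : E → ℝ}
    (hb : Stop F T b) (N : ℕ) : Integrable (gI X t N b) P := by
  have m : ∀ i ≤ N + 1, Integrable (X (gp t N i)) P := fun i hi =>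
    hM.1 _ ⟨(gp_mem ht hi).1, (gp_mem ht hi).2.trans ht.2⟩
  unfold gI
  refine Integrable.add ?_ (integrable_finsetSum _ fun i hi => ?_)
  · have := m 0 (by omega); rwa [gp_zero] at this
  · rw [Finset.mem_range] at hi
    have m1 := gp_mem ht (show i ≤ N + 1 by omega)
    have := ((m (i+1) (by omega)).sub (m i (by omega))).indicator
      (hle _ _ (hb.lt ⟨m1.1, m1.2.trans ht.2⟩))
    refine this.congr (ae_of_all _ fun ω => ?_)
    simp [indicator]

lemma gI_ui {E : Type*} [mE : MeasurableSpace E] {P : Measure E} [IsProbabilityMeasure P]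
    {F : ℝ → MeasurableSpace E} (hle : ∀ t, F t ≤ mE) (hF : Monotone F) {T : ℝ} {X : ℝ → E → ℝ}
    (hX : CA F T X) (hM : Mart P F T X) {t : ℝ} (ht : t ∈ Icc (0:ℝ) T) {b : E → ℝ}
    (hb : Stop F T b) : UniformIntegrable (fun N => gI X t N b) 1 P := by
  have hm : ∀ N, Measurable (gI X t N b) := fun N =>
    (gI_meas hF hX ht hb N).mono (hle t) le_rfl
  have hG : ∀ N : ℕ, MeasurableSpace.comap (gI X t N b) inferInstance ≤ mE :=
    fun N => (hm N).comap_le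
  refine (Integrable.uniformIntegrable_condExp (hM.1 t ht) hG).ae_eq fun N => ?_
  symm
  refine ae_eq_condExp_of_forall_setIntegral_eq (hG N) (hM.1 t ht)
    (fun _ _ _ => (gI_integrable hle hM ht hb N).integrableOn) ?_
    (comap_measurable _).stronglyMeasurable.aestronglyMeasurable
  rintro A ⟨B, hB, rfl⟩ _
  set h : E → ℝ := fun ω => if gI X t N b ω ∈ B then 1 else 0 with hh
  have hI := grid_mean (P := P) (C := 1) hle hM ht (a := b) (b := fun ω => max (b ω) (t + 1)) (h := h)
    ?_ (fun ω => le_max_left _ _) N ?_ zero_le_one (ae_of_all _ fun ω => by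
      simp only [hh]; split_ifs <;> simp)
  · have e : ∀ ω, gI X t N (fun ω => max (b ω) (t + 1)) ω = X t ω := by
      intro ω
      unfold gI
      have : ∀ i ∈ Finset.range (N + 1), (if gp t N i < max (b ω) (t + 1) then
          X (gp t N (i + 1)) ω - X (gp t N i) ω else 0)
          = X (gp t N (i + 1)) ω - X (gp t N i) ω := by
        intro i hi
        rw [Finset.mem_range] at hi
        have m1 := gp_mem ht (show i ≤ N + 1 by omega)
        rw [if_pos]
        exact lt_of_lt_of_le (by linarith [m1.2]) (le_max_right _ _)
      rw [Finset.sum_congr rfl this, Finset.sum_range_sub (fun i => X (gp t N i) ω), gp_last, gp_zero]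
      ring
    simp_rw [e] at hI
    have hS := hm N hB
    have i1 := (gI_integrable hle hM ht hb N).indicator hS
    have i2 := (hM.1 t ht).indicator hS
    rw [← integral_indicator hS, ← integral_indicator hS, eq_comm, ← sub_eq_zero, ← integral_sub i2 i1,
      ← hI]
    congr 1
    ext ω
    simp only [hh, indicator, mem_preimage]
    split_ifs <;> simp
  · intro u hu
    rcases le_or_gt (t + 1) u with h1 | h1
    · convert hb u hu using 1
      ext ω; simp [h1]
    · convert @MeasurableSet.empty _ (F u)
      ext ω; simp; intro _; exact h1
  · intro i hi
    have m1 := gp_mem ht (show i ≤ N + 1 by omega)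
    have m1' : gp t N i ∈ Icc (0:ℝ) T := ⟨m1.1, m1.2.trans ht.2⟩
    have m : ∀ j ≤ i, Measurable[F (gp t N i)] (X (gp t N j)) := fun j hj =>
      (hX.adapted _ ⟨(gp_mem ht (show j ≤ N + 1 by omega)).1,
        (gp_mem ht (show j ≤ N + 1 by omega)).2.trans ht.2⟩).mono (hF (gp_mono ht.1 hj)) le_rfl
    have m2 : Measurable[F (gp t N i)] (fun ω => X 0 ω + ∑ j ∈ Finset.range i,
        if gp t N j < b ω then X (gp t N (j + 1)) ω - X (gp t N j) ω else 0) := by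
      refine Measurable.add ?_ (Finset.measurable_fun_sum _ fun j hj => ?_)
      · have := m 0 (by omega); rwa [gp_zero] at this
      · rw [Finset.mem_range] at hj
        refine Measurable.ite ?_ ((m _ (by omega)).sub (m _ (by omega))) measurable_const
        have := gp_mem ht (show j ≤ N + 1 by omega)
        exact hF (gp_mono ht.1 hj.le) _ (hb.lt ⟨this.1, this.2.trans ht.2⟩)
    have m3 : Measurable[F (gp t N i)] (fun ω => if b ω ≤ gp t N i then
        (if (X 0 ω + ∑ j ∈ Finset.range i,
        if gp t N j < b ω then X (gp t N (j + 1)) ω - X (gp t N j) ω else 0) ∈ B then (1:ℝ) else 0)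
        else 0) :=
      Measurable.ite (hb _ m1') (Measurable.ite (m2 hB) measurable_const measurable_const)
        measurable_const
    convert m3 using 2 with ω
    by_cases hbi : b ω ≤ gp t N i
    · simp only [hbi, if_true, hh]
      have : gI X t N b ω = X 0 ω + ∑ j ∈ Finset.range i,
        if gp t N j < b ω then X (gp t N (j + 1)) ω - X (gp t N j) ω else 0 := by
        unfold gI
        congr 1
        symm
        refine Finset.sum_subset (Finset.range_mono (by omega)) ?_
        intro j _ hj
        rw [Finset.mem_range, not_lt] at hj
        rw [if_neg]
        exact not_lt.mpr (hbi.trans (gp_mono ht.1 hj))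
      rw [this]
    · simp [hbi]

/-- Optional sampling. -/
theorem OS {E : Type*} [mE : MeasurableSpace E] {P : Measure E} [IsProbabilityMeasure P]
    {F : ℝ → MeasurableSpace E} (hle : ∀ t, F t ≤ mE) (hF : Monotone F) {T : ℝ} {X : ℝ → E → ℝ}
    (hX : CA F T X) (hM : Mart P F T X) {t : ℝ} (ht : t ∈ Icc (0:ℝ) T) {a b : E → ℝ}
    (ha : Stop F T a) (hb : Stop F T b) (hab : ∀ ω, a ω ≤ b ω) {h : E → ℝ}
    (hh : MeasAt F T a h) {C : ℝ} (hC : ∀ᵐ ω ∂P, |h ω| ≤ C) :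
    ∫ ω, h ω * (X (min (b ω) t) ω - X (min (a ω) t) ω) ∂P = 0 := by
  have hC' : ∀ᵐ ω ∂P, |h ω| ≤ max C 0 := hC.mono fun ω h => h.trans (le_max_left _ _)
  have hC0 : 0 ≤ max C 0 := le_max_right _ _
  set h' : E → ℝ := fun ω => if a ω ≤ t then h ω else 0 with hh'
  have hC1 : ∀ᵐ ω ∂P, ‖h' ω‖ ≤ max C 0 := by
    filter_upwards [hC'] with ω hω
    simp only [hh']; split_ifs <;> simp [hω] <;> simpa using hω
  have e : ∀ ω, h ω * (X (min (b ω) t) ω - X (min (a ω) t) ω)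
      = h' ω * (X (min (b ω) t) ω - X (min (a ω) t) ω) := by
    intro ω
    simp only [hh']
    split_ifs with h1
    · rfl
    · push Not at h1
      rw [min_eq_right h1.le, min_eq_right (h1.le.trans (hab ω))]; simp
  simp_rw [e]
  have L1 : ∀ c : E → ℝ, Stop F T c → MemLp (fun ω => X (min (c ω) t) ω) 1 P ∧
      Tendsto (fun N => eLpNorm (gI X t N c - fun ω => X (min (c ω) t) ω) 1 P) atTop (𝓝 0) := by
    intro c hc
    have hui := gI_ui hle hF hX hM ht hc (P := P)
    have hlim : ∀ᵐ ω ∂P, Tendsto (fun N => gI X t N c ω) atTop (𝓝 (X (min (c ω) t) ω)) :=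
      ae_of_all _ fun ω => gI_tendsto hX ht.1 c ω
    have hmem := hui.memLp_of_ae_tendsto hlim
    exact ⟨hmem, tendsto_Lp_finite_of_tendsto_ae le_rfl (by simp)
      (fun N => ((gI_meas hF hX ht hc N).mono (hle t) le_rfl).aestronglyMeasurable) hmem hui.2.1 hlim⟩
  have hm' : AEStronglyMeasurable h' P :=
    ((hh t ht).mono (hle t) le_rfl).aestronglyMeasurable
  have T1 : ∀ c : E → ℝ, Stop F T c →
      Tendsto (fun N => ∫ ω, h' ω * gI X t N c ω ∂P) atTop (𝓝 (∫ ω, h' ω * X (min (c ω) t) ω ∂P)) := by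
    intro c hc
    obtain ⟨hmem, hlim⟩ := L1 c hc
    have ig := memLp_one_iff_integrable.1 hmem
    refine tendsto_integral_of_L1' (fun ω => h' ω * X (min (c ω) t) ω) (ig.bdd_mul hm' hC1).1
      (Eventually.of_forall fun N => (gI_integrable hle hM ht hc N).bdd_mul hm' hC1) ?_
    have : Tendsto (fun N => ENNReal.ofReal (max C 0) *
      eLpNorm (gI X t N c - fun ω => X (min (c ω) t) ω) 1 P) atTop (𝓝 0) := by
      have := ENNReal.Tendsto.const_mul hlim (Or.inr (ENNReal.ofReal_ne_top (r := max C 0)))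
      simpa using this
    refine tendsto_of_tendsto_of_tendsto_of_le_of_le tendsto_const_nhds this (fun _ => zero_le) ?_
    intro N
    show _ ≤ _
    refine eLpNorm_le_mul_eLpNorm_of_ae_le_mul (f := ((fun ω => h' ω * gI X t N c ω) - fun ω => h' ω * X (min (c ω) t) ω)) ?_ 1
    filter_upwards [hC1] with ω hω
    simp only [Pi.sub_apply, ← mul_sub, norm_mul]
    gcongr
  have T2 := (T1 b hb).sub (T1 a ha)
  have e2 : ∀ N, ∫ ω, h' ω * gI X t N b ω ∂P - ∫ ω, h' ω * gI X t N a ω ∂P = 0 := by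
    intro N
    rw [← integral_sub ((gI_integrable hle hM ht hb N).bdd_mul hm' hC1)
      ((gI_integrable hle hM ht ha N).bdd_mul hm' hC1)]
    simp_rw [← mul_sub]
    refine grid_mean hle hM ht hb hab N ?_ hC0 hC1
    intro i hi
    have m1 := gp_mem ht (show i ≤ N + 1 by omega)
    convert hh _ ⟨m1.1, m1.2.trans ht.2⟩ using 2 with ω
    simp only [hh']
    by_cases h3 : a ω ≤ gp t N i
    · simp [h3, h3.trans m1.2]
    · simp [h3]
  simp_rw [e2] at T2
  have T3 := tendsto_nhds_unique T2 tendsto_const_nhds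
  rw [← integral_sub ((memLp_one_iff_integrable.1 (L1 b hb).1).bdd_mul hm' hC1)
      ((memLp_one_iff_integrable.1 (L1 a ha).1).bdd_mul hm' hC1)] at T3
  simp_rw [← mul_sub] at T3
  exact T3

end PathwiseSuperhedging

namespace PathwiseSuperhedging

section alg
variable {E : Type*} {F : ℝ → MeasurableSpace E} {T : ℝ} {X Y : ℝ → E → ℝ}

lemma CA.add (hX : CA F T X) (hY : CA F T Y) : CA F T (fun t ω => X t ω + Y t ω) where
  cont ω := (hX.cont ω).add (hY.cont ω)
  adapted t ht := (hX.adapted t ht).add (hY.adapted t ht)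
  neg t ht ω := by rw [hX.neg t ht, hY.neg t ht]

lemma CA.sub (hX : CA F T X) (hY : CA F T Y) : CA F T (fun t ω => X t ω - Y t ω) where
  cont ω := (hX.cont ω).sub (hY.cont ω)
  adapted t ht := (hX.adapted t ht).sub (hY.adapted t ht)
  neg t ht ω := by rw [hX.neg t ht, hY.neg t ht]

lemma CA.mul (hX : CA F T X) (hY : CA F T Y) : CA F T (fun t ω => X t ω * Y t ω) where
  cont ω := (hX.cont ω).mul (hY.cont ω)
  adapted t ht := (hX.adapted t ht).mul (hY.adapted t ht)
  neg t ht ω := by rw [hX.neg t ht, hY.neg t ht]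

lemma CA.comp (hX : CA F T X) {f : ℝ → ℝ} (hf : Continuous f) : CA F T (fun t ω => f (X t ω)) where
  cont ω := hf.comp (hX.cont ω)
  adapted t ht := hf.measurable.comp (hX.adapted t ht)
  neg t ht ω := by rw [hX.neg t ht]

lemma CA.const (c : ℝ) : CA F T (fun _ _ => c) where
  cont ω := continuous_const
  adapted t ht := measurable_const
  neg t ht ω := rfl

lemma CA.sum {ι : Type*} {X : ι → ℝ → E → ℝ} (s : Finset ι) (hX : ∀ i, CA F T (X i)) :
    CA F T (fun t ω => ∑ i ∈ s, X i t ω) where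
  cont ω := continuous_finsetSum _ fun i _ => (hX i).cont ω
  adapted t ht := Finset.measurable_fun_sum _ fun i _ => (hX i).adapted t ht
  neg t ht ω := Finset.sum_congr rfl fun i _ => (hX i).neg t ht ω

lemma CA.init (hF : Monotone F) (hX : CA F T X) : CA F T (fun _ ω => X 0 ω) where
  cont ω := continuous_const
  adapted t ht := (hX.adapted 0 ⟨le_rfl, ht.1.trans ht.2⟩).mono (hF ht.1) le_rfl
  neg t ht ω := rfl

lemma CA.neg' (hX : CA F T X) (t : ℝ) (ω : E) : X t ω = X (max t 0) ω := by
  rcases le_total t 0 with h | h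
  · rw [max_eq_right h, hX.neg t h]
  · rw [max_eq_left h]

variable {a b : E → ℝ}

lemma Stop.min (ha : Stop F T a) (hb : Stop F T b) : Stop F T (fun ω => min (a ω) (b ω)) := by
  intro t ht
  convert (ha t ht).union (hb t ht) using 1
  ext; simp

lemma Stop.max (ha : Stop F T a) (hb : Stop F T b) : Stop F T (fun ω => max (a ω) (b ω)) := by
  intro t ht
  convert (ha t ht).inter (hb t ht) using 1
  ext; simp

lemma Stop.const (c : ℝ) : Stop F T (fun _ => c) := fun t _ =>
  @MeasurableSet.const E (F t) (c ≤ t)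

variable {h g : E → ℝ}

lemma MeasAt.of_stopped (hF : Monotone F) (hX : CA F T X) (ha : Stop F T a) :
    MeasAt F T a (fun ω => X (a ω) ω) := by
  intro u hu
  convert Measurable.ite (ha u hu) (stopped_meas hF hX hu ha) measurable_const using 2 with ω
  · split_ifs with h1
    · rw [min_eq_left h1]
    · rfl
  all_goals infer_instance

lemma MeasAt.mul (hh : MeasAt F T a h) (hg : MeasAt F T a g) : MeasAt F T a (fun ω => h ω * g ω) := by
  intro u hu
  convert (hh u hu).mul (hg u hu) using 2 with ω
  by_cases h1 : a ω ≤ u <;> simp [h1]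

lemma MeasAt.comp (ha : Stop F T a) (hh : MeasAt F T a h) {f : ℝ → ℝ} (hf : Measurable f) :
    MeasAt F T a (fun ω => f (h ω)) := by
  intro u hu
  convert Measurable.ite (ha u hu) (hf.comp (hh u hu)) (measurable_const (a := (0:ℝ))) using 2 with ω
  · by_cases h1 : a ω ≤ u <;> simp [h1]
  all_goals infer_instance

lemma MeasAt.mono (hb : Stop F T b) (hab : ∀ ω, a ω ≤ b ω) (hh : MeasAt F T a h) :
    MeasAt F T b h := by
  intro u hu
  convert Measurable.ite (hb u hu) (hh u hu) (measurable_const (a := (0:ℝ))) using 2 with ω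
  · by_cases h1 : b ω ≤ u
    · simp [h1, (hab ω).trans h1]
    · simp [h1]
  all_goals infer_instance

lemma MeasAt.const (hF : Monotone F) {s : ℝ} {h : E → ℝ} (hh : Measurable[F s] h) :
    MeasAt F T (fun _ => s) h := by
  intro u hu
  by_cases h1 : s ≤ u
  · simpa [h1] using hh.mono (hF h1) le_rfl
  · simpa [h1] using measurable_const

end alg

section hit
variable {E : Type*}

def hit (T c d : ℝ) (Y : ℝ → E → ℝ) (ω : E) : ℝ :=
  sInf ({t : ℝ | 0 ≤ t ∧ t ≤ T ∧ c ≤ Y t ω} ∪ {d})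

lemma hit_cases {T c d : ℝ} (hd : T < d) {Y : ℝ → E → ℝ} {ω : E} (hY : Continuous fun t => Y t ω) :
    (hit T c d Y ω = d ∧ ∀ t, 0 ≤ t → t ≤ T → Y t ω < c) ∨
    (0 ≤ hit T c d Y ω ∧ hit T c d Y ω ≤ T ∧ c ≤ Y (hit T c d Y ω) ω ∧
      ∀ t, 0 ≤ t → t < hit T c d Y ω → Y t ω < c) := by
  set A : Set ℝ := {t : ℝ | 0 ≤ t ∧ t ≤ T ∧ c ≤ Y t ω} with hA
  rcases A.eq_empty_or_nonempty with h | h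
  · left
    refine ⟨by unfold hit; rw [← hA, h]; simp, fun t h0 h1 => ?_⟩
    by_contra h2
    push Not at h2
    have : t ∈ A := ⟨h0, h1, h2⟩
    rw [h] at this; exact this
  · right
    have hc : IsCompact A := by
      have : A = Icc 0 T ∩ {t | c ≤ Y t ω} := by ext t; simp [hA, and_assoc]
      rw [this]
      exact isCompact_Icc.inter_right (isClosed_le continuous_const hY)
    obtain ⟨x, hx, hx2⟩ := hc.exists_isLeast h
    have e : hit T c d Y ω = x := by
      refine IsLeast.csInf_eq ⟨Or.inl hx, ?_⟩
      rintro y (hy | hy)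
      · exact hx2 hy
      · rw [mem_singleton_iff.1 hy]; linarith [hx.2.1]
    rw [e]
    refine ⟨hx.1, hx.2.1, hx.2.2, fun t h0 h1 => ?_⟩
    by_contra h2
    push Not at h2
    exact absurd (hx2 ⟨h0, by linarith [hx.2.1], h2⟩) (not_le.2 h1)

lemma hit_nonneg {T c d : ℝ} (hT : 0 ≤ T) (hd : T < d) {Y : ℝ → E → ℝ} {ω : E}
    (hY : Continuous fun t => Y t ω) : 0 ≤ hit T c d Y ω := by
  rcases hit_cases (c := c) hd hY with h | h
  · rw [h.1]; linarith
  · exact h.1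

lemma hit_le {T c d : ℝ} (hd : T < d) {Y : ℝ → E → ℝ} {ω : E} (hY : Continuous fun t => Y t ω)
    {t : ℝ} (h0 : 0 ≤ t) (hT : t ≤ T) (ht : t ≤ hit T c d Y ω) : Y t ω ≤ max c (Y 0 ω) := by
  rcases hit_cases (c := c) hd hY with h | h
  · exact (h.2 t h0 hT).le.trans (le_max_left _ _)
  · rcases ht.lt_or_eq with h1 | h1
    · exact (h.2.2.2 t h0 h1).le.trans (le_max_left _ _)
    · rcases h0.eq_or_lt with h2 | h2
      · rw [← h2]; exact le_max_right _ _
      · refine le_trans ?_ (le_max_left _ _)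
        have : Tendsto (fun s => Y s ω) (𝓝[<] t) (𝓝 (Y t ω)) :=
          (hY.tendsto t).mono_left nhdsWithin_le_nhds
        refine le_of_tendsto this ?_
        have : Ioo 0 t ∈ 𝓝[<] t := Ioo_mem_nhdsLT h2
        filter_upwards [this] with s hs
        exact (h.2.2.2 s hs.1.le (h1 ▸ hs.2)).le

lemma hit_gt {T c d : ℝ} (hd : T < d) {Y : ℝ → E → ℝ} {ω : E} (hY : Continuous fun t => Y t ω)
    (h : ∀ t, 0 ≤ t → t ≤ T → Y t ω < c) : hit T c d Y ω = d := by
  rcases hit_cases (c := c) hd hY with h1 | h1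
  · exact h1.1
  · exact absurd h1.2.2.1 (not_le.2 (h _ h1.1 h1.2.1))

lemma hit_stop {F : ℝ → MeasurableSpace E} (hF : Monotone F) {T c d : ℝ} (hd : T < d)
    {Y : ℝ → E → ℝ} (hY : CA F T Y) : Stop F T (hit T c d Y) := by
  intro t ht
  have e : {ω | hit T c d Y ω ≤ t} = ⋂ k : ℕ, ⋃ q : {q : ℚ // (q:ℝ) ∈ Icc (0:ℝ) 1},
      {ω | c - 1 / (k + 1) < Y (t * q) ω} := by
    ext ω
    simp only [mem_ofPred_eq, mem_iInter, mem_iUnion]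
    constructor
    · intro h k
      rcases hit_cases (c := c) hd (hY.cont ω) with h1 | h1
      · rw [h1.1] at h; linarith [ht.2]
      · set x := hit T c d Y ω
        rcases ht.1.eq_or_lt with h0 | h0
        · refine ⟨⟨0, by simp⟩, ?_⟩
          have : x = t * ((0:ℚ):ℝ) := by simp; linarith
          rw [← this]
          have : (0:ℝ) < 1 / (k + 1) := by positivity
          linarith
        have hop : IsOpen {s : ℝ | c - 1 / (k + 1) < Y (t * s) ω} :=
          isOpen_lt continuous_const ((hY.cont ω).comp (continuous_const.mul continuous_id))
        have hx : x / t ∈ {s : ℝ | c - 1 / (k + 1) < Y (t * s) ω} ∩ Icc 0 1 := by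
          refine ⟨?_, div_nonneg h1.1 h0.le, (div_le_one h0).2 h⟩
          show _ < Y (t * (x / t)) ω
          have : t * (x / t) = x := by field_simp
          rw [this]
          have : (0:ℝ) < 1 / (k + 1) := by positivity
          linarith [h1.2.2.1]
        have hcl : x / t ∈ closure (Ioo (0:ℝ) 1) := by
          rw [closure_Ioo (by norm_num)]; exact hx.2
        obtain ⟨y, hy1, hy2⟩ := mem_closure_iff.1 hcl _ hop hx.1
        obtain ⟨q, hq⟩ := Rat.denseRange_cast.exists_mem_open (hop.inter isOpen_Ioo) ⟨y, hy1, hy2⟩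
        exact ⟨⟨q, hq.2.1.le, hq.2.2.le⟩, hq.1⟩
    · intro h
      by_contra h1
      push Not at h1
      have hlt : ∀ s ∈ Icc (0:ℝ) t, Y s ω < c := by
        intro s hs
        rcases hit_cases (c := c) hd (hY.cont ω) with h2 | h2
        · exact h2.2 s hs.1 (hs.2.trans ht.2)
        · exact h2.2.2.2 s hs.1 (hs.2.trans_lt h1)
      obtain ⟨x, hx, hx2⟩ := isCompact_Icc.exists_isMaxOn (nonempty_Icc.2 ht.1)
        (hY.cont ω).continuousOn
      obtain ⟨k, hk⟩ := exists_nat_one_div_lt (sub_pos.2 (hlt x hx))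
      obtain ⟨q, hq⟩ := h k
      have : t * (q:ℝ) ∈ Icc 0 t := ⟨mul_nonneg ht.1 q.2.1, mul_le_of_le_one_right ht.1 q.2.2⟩
      have := hx2 this
      simp only [mem_ofPred_eq] at this
      linarith
  rw [e]
  refine MeasurableSet.iInter fun k => MeasurableSet.iUnion fun q => ?_
  have hq : t * (q:ℝ) ∈ Icc 0 t := ⟨mul_nonneg ht.1 q.2.1, mul_le_of_le_one_right ht.1 q.2.2⟩
  have := (hY.adapted _ ⟨hq.1, hq.2.trans ht.2⟩).mono (hF hq.2) le_rfl
  exact measurableSet_lt measurable_const this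
end hit

end PathwiseSuperhedging

namespace PathwiseSuperhedging

section mart
variable {E : Type*} [mE : MeasurableSpace E] {P : Measure E}
  {F : ℝ → MeasurableSpace E} {T : ℝ} {X Y : ℝ → E → ℝ}

lemma Mart.add (hX : Mart P F T X) (hY : Mart P F T Y) : Mart P F T (fun t ω => X t ω + Y t ω) := by
  refine ⟨fun t ht => (hX.1 t ht).add (hY.1 t ht), fun s t hs ht hst A hA => ?_⟩
  rw [integral_add (hX.1 t ht).integrableOn (hY.1 t ht).integrableOn,
    integral_add (hX.1 s hs).integrableOn (hY.1 s hs).integrableOn,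
    hX.2 s t hs ht hst A hA, hY.2 s t hs ht hst A hA]

lemma Mart.const_mul (c : ℝ) (hX : Mart P F T X) : Mart P F T (fun t ω => c * X t ω) := by
  refine ⟨fun t ht => (hX.1 t ht).const_mul c, fun s t hs ht hst A hA => ?_⟩
  rw [integral_const_mul, integral_const_mul, hX.2 s t hs ht hst A hA]

lemma Mart.sub (hX : Mart P F T X) (hY : Mart P F T Y) : Mart P F T (fun t ω => X t ω - Y t ω) := by
  have := hX.add (hY.const_mul (-1))
  simpa [sub_eq_add_neg] using this

lemma Mart.sum {ι : Type*} {X : ι → ℝ → E → ℝ} (S : Finset ι) (hX : ∀ i, Mart P F T (X i)) :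
    Mart P F T (fun t ω => ∑ i ∈ S, X i t ω) := by
  refine ⟨fun t ht => integrable_finsetSum _ fun i _ => (hX i).1 t ht, fun s t hs ht hst A hA => ?_⟩
  rw [integral_finsetSum _ fun i _ => ((hX i).1 t ht).integrableOn,
    integral_finsetSum _ fun i _ => ((hX i).1 s hs).integrableOn]
  exact Finset.sum_congr rfl fun i _ => (hX i).2 s t hs ht hst A hA

lemma Mart.congr (hX : Mart P F T X) (h : ∀ t ∈ Icc (0:ℝ) T, X t =ᵐ[P] Y t) : Mart P F T Y := by
  refine ⟨fun t ht => (hX.1 t ht).congr (h t ht), fun s t hs ht hst A hA => ?_⟩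
  rw [← integral_congr_ae (ae_restrict_of_ae (h t ht)), ← integral_congr_ae (ae_restrict_of_ae (h s hs))]
  exact hX.2 s t hs ht hst A hA

lemma Mart.lim [IsProbabilityMeasure P] {X : ℕ → ℝ → E → ℝ} (hX : ∀ n, Mart P F T (X n)) {C : ℝ}
    (hC : ∀ n, ∀ t ∈ Icc (0:ℝ) T, ∀ᵐ ω ∂P, |X n t ω| ≤ C)
    (hl : ∀ t ∈ Icc (0:ℝ) T, ∀ᵐ ω ∂P, Tendsto (fun n => X n t ω) atTop (𝓝 (Y t ω))) :
    Mart P F T Y := by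
  have hm : ∀ t ∈ Icc (0:ℝ) T, AEStronglyMeasurable (Y t) P := fun t ht =>
    aestronglyMeasurable_of_tendsto_ae atTop (fun n => ((hX n).1 t ht).1) (hl t ht)
  have hb : ∀ t ∈ Icc (0:ℝ) T, ∀ᵐ ω ∂P, |Y t ω| ≤ C := by
    intro t ht
    filter_upwards [hl t ht, ae_all_iff.2 fun n => hC n t ht] with ω h1 h2
    exact le_of_tendsto h1.abs (Eventually.of_forall h2)
  have hlim : ∀ t ∈ Icc (0:ℝ) T, ∀ A : Set E,
      Tendsto (fun n => ∫ ω in A, X n t ω ∂P) atTop (𝓝 (∫ ω in A, Y t ω ∂P)) := by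
    intro t ht A
    refine tendsto_integral_of_dominated_convergence (fun _ => C)
      (fun n => ((hX n).1 t ht).1.restrict) (integrable_const _) (fun n => ?_) ?_
    · exact ae_restrict_of_ae (hC n t ht)
    · exact ae_restrict_of_ae (hl t ht)
  refine ⟨fun t ht => Integrable.of_bound (hm t ht) C (hb t ht), fun s t hs ht hst A hA => ?_⟩
  refine tendsto_nhds_unique (hlim t ht A) ?_
  simp_rw [fun n => (hX n).2 s t hs ht hst A hA]
  exact hlim s hs A

lemma os_integrable [IsProbabilityMeasure P] (hle : ∀ t, F t ≤ mE) (hF : Monotone F)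
    (hX : CA F T X) (hM : Mart P F T X) {t : ℝ} (ht : t ∈ Icc (0:ℝ) T) {b : E → ℝ}
    (hb : Stop F T b) : Integrable (fun ω => X (min (b ω) t) ω) P := by
  have hui := gI_ui hle hF hX hM ht hb (P := P)
  exact memLp_one_iff_integrable.1 (hui.memLp_of_ae_tendsto
    (ae_of_all _ fun ω => gI_tendsto hX ht.1 b ω))

lemma SI_CA (hF : Monotone F) (hX : CA F T X) {a b : E → ℝ} (ha : Stop F T a) (hb : Stop F T b)
    (hab : ∀ ω, a ω ≤ b ω) {h : E → ℝ} (hh : MeasAt F T a h) :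
    CA F T (fun t ω => h ω * (X (min (b ω) t) ω - X (min (a ω) t) ω)) where
  cont ω := continuous_const.mul (((hX.stopped hF hb).cont ω).sub ((hX.stopped hF ha).cont ω))
  adapted t ht := by
    convert (hh t ht).mul ((stopped_meas hF hX ht hb).sub (stopped_meas hF hX ht ha)) using 2 with ω
    by_cases h1 : a ω ≤ t
    · simp [h1]
    · push Not at h1
      rw [min_eq_right h1.le, min_eq_right (h1.le.trans (hab ω))]; simp
      intro h2; exact absurd h2 (not_le.2 h1)
  neg t ht ω := by
    have := (hX.stopped hF hb).neg t ht ω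
    have := (hX.stopped hF ha).neg t ht ω
    simp_all

lemma maxmin (f : ℝ → ℝ) (x : ℝ) {s t : ℝ} (hst : s ≤ t) :
    f (min (max x s) t) = f (min x t) + f s - f (min x s) := by
  rcases le_total x s with h | h
  · rw [max_eq_right h, min_eq_left hst, min_eq_left h, min_eq_left (h.trans hst)]; ring
  · rw [max_eq_left h, min_eq_right h]; ring

lemma SI_Mart [IsProbabilityMeasure P] (hle : ∀ t, F t ≤ mE) (hF : Monotone F)
    (hX : CA F T X) (hM : Mart P F T X) {a b : E → ℝ} (ha : Stop F T a) (hb : Stop F T b)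
    (hab : ∀ ω, a ω ≤ b ω) {h : E → ℝ} (hh : MeasAt F T a h) {C : ℝ} (hC : ∀ᵐ ω ∂P, |h ω| ≤ C) :
    Mart P F T (fun t ω => h ω * (X (min (b ω) t) ω - X (min (a ω) t) ω)) := by
  have hint : ∀ t ∈ Icc (0:ℝ) T,
      Integrable (fun ω => h ω * (X (min (b ω) t) ω - X (min (a ω) t) ω)) P := by
    intro t ht
    have i1 := (os_integrable hle hF hX hM ht hb).sub (os_integrable hle hF hX hM ht ha)
    refine Integrable.mono' (i1.norm.const_mul C)
      (((SI_CA hF hX ha hb hab hh).adapted t ht).mono (hle t) le_rfl).aestronglyMeasurable ?_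
    filter_upwards [hC] with ω hω
    rw [norm_mul]
    exact mul_le_mul_of_nonneg_right hω (norm_nonneg _)
  refine ⟨hint, fun s t hs ht hst A hA => ?_⟩
  have hA' := hle s _ hA
  rw [← sub_eq_zero, ← integral_sub (hint t ht).integrableOn (hint s hs).integrableOn,
    ← integral_indicator hA']
  have := OS (P := P) hle hF hX hM ht (a := fun ω => max (a ω) s) (b := fun ω => max (b ω) s)
    (ha.max (Stop.const s)) (hb.max (Stop.const s)) (fun ω => max_le_max_right _ (hab ω))
    (h := fun ω => h ω * A.indicator (fun _ => (1:ℝ)) ω) (C := C) ?_ ?_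
  · rw [← this]
    congr 1
    ext ω
    rw [maxmin (fun u => X u ω) _ hst, maxmin (fun u => X u ω) _ hst]
    by_cases h1 : ω ∈ A <;> simp [h1]
    ring
  · refine MeasAt.mul (MeasAt.mono (ha.max (Stop.const s)) (fun ω => le_max_left _ _) hh)
      (MeasAt.mono (ha.max (Stop.const s)) (fun ω => le_max_right _ _)
        (MeasAt.const (s := s) hF ?_))
    exact measurable_const.indicator hA
  · filter_upwards [hC] with ω hω
    by_cases h1 : ω ∈ A
    · simp [h1, hω]
    · simp [h1, (abs_nonneg _).trans hω]

lemma locmart_mart [IsProbabilityMeasure P] (hle : ∀ t, F t ≤ mE) (hF : Monotone F)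
    (hX : CA F T X) (hM : LocMart P F T X) {r : E → ℝ} (hr : Stop F T r) {C : ℝ}
    (hC : ∀ᵐ ω ∂P, ∀ t ∈ Icc (0:ℝ) T, |X (min (r ω) t) ω - X 0 ω| ≤ C) :
    Mart P F T (fun t ω => X (min (r ω) t) ω - X 0 ω) := by
  obtain ⟨τ, hτ, hτ2, hτ3⟩ := hM
  have hca := (hX.stopped hF hr).sub (hX.init hF)
  have hint : ∀ t ∈ Icc (0:ℝ) T, Integrable (fun ω => X (min (r ω) t) ω - X 0 ω) P := fun t ht =>
    Integrable.of_bound ((hca.adapted t ht).mono (hle t) le_rfl).aestronglyMeasurable C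
      (hC.mono fun ω h => h t ht)
  refine ⟨hint, fun s t hs ht hst A hA => ?_⟩
  have hA' := hle s _ hA
  rw [← sub_eq_zero, ← integral_sub (hint t ht).integrableOn (hint s hs).integrableOn,
    ← integral_indicator hA']
  have hz : ∀ m, ∫ ω, A.indicator (fun _ => (1:ℝ)) ω *
      (X (min (τ m ω) (min (max (r ω) s) t)) ω - X (min (τ m ω) (min s t)) ω) ∂P = 0 := fun m =>
    OS (P := P) hle hF (hX.stopped hF (hτ m)) (hτ3 m) ht (a := fun ω => s) (b := fun ω => max (r ω) s)
      (Stop.const s) (hr.max (Stop.const s)) (fun ω => le_max_right _ _) (C := 1)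
      (MeasAt.const (s := s) hF (measurable_const.indicator hA)) (ae_of_all _ fun ω => by
        by_cases h1 : ω ∈ A <;> simp [h1])
  have hlim : Tendsto (fun m => ∫ ω, A.indicator (fun _ => (1:ℝ)) ω *
      (X (min (τ m ω) (min (max (r ω) s) t)) ω - X (min (τ m ω) (min s t)) ω) ∂P) atTop
      (𝓝 (∫ ω, A.indicator (fun ω => X (min (r ω) t) ω - X 0 ω - (X (min (r ω) s) ω - X 0 ω)) ω ∂P)) := by
    have hst' : Stop F T (fun ω => min (max (r ω) s) t) := (hr.max (Stop.const s)).min (Stop.const t)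
    refine tendsto_integral_of_dominated_convergence (fun _ => 2 * C) (fun m => ?_)
      (integrable_const _) (fun m => ?_) ?_
    · refine AEStronglyMeasurable.mul ?_ (AEStronglyMeasurable.sub ?_ ?_)
      · exact (measurable_const.indicator hA').aestronglyMeasurable
      · have := stopped_meas hF hX ht ((hτ m).min (hr.max (Stop.const s)))
        simp_rw [min_assoc] at this
        exact (this.mono (hle t) le_rfl).aestronglyMeasurable
      · have := stopped_meas hF hX ht ((hτ m).min (Stop.const s))
        simp_rw [min_assoc] at this
        exact (this.mono (hle t) le_rfl).aestronglyMeasurable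
    · filter_upwards [hC] with ω hω
      have hb : ∀ u ≤ T, |X (min (r ω) u) ω - X 0 ω| ≤ C := by
        intro u hu
        rcases le_total 0 u with h0 | h0
        · exact hω u ⟨h0, hu⟩
        · rw [hX.neg _ ((min_le_right _ _).trans h0)]
          simp
          exact (abs_nonneg _).trans (hω s hs)
      have hC0 : 0 ≤ C := (abs_nonneg _).trans (hω s hs)
      rw [min_eq_left hst]
      have key : |X (min (τ m ω) (min (max (r ω) s) t)) ω - X (min (τ m ω) s) ω| ≤ 2 * C := by
        rcases le_total (r ω) s with h | h
        · rw [max_eq_right h, min_eq_left hst]; simp; exact hC0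
        · rw [max_eq_left h, show min (τ m ω) (min (r ω) t) = min (r ω) (min (τ m ω) t) from
            min_left_comm _ _ _, show min (τ m ω) s = min (r ω) (min (τ m ω) s) by
              rw [min_left_comm, min_eq_right h]]
          have h1 := hb (min (τ m ω) t) ((min_le_right _ _).trans ht.2)
          have h2 := hb (min (τ m ω) s) ((min_le_right _ _).trans hs.2)
          rw [abs_le] at *
          constructor <;> linarith [h1.1, h1.2, h2.1, h2.2]
      by_cases h1 : ω ∈ A
      · simpa [h1] using key
      · simp [h1, hC0]
    · filter_upwards [hτ2] with ω hω
      refine tendsto_const_nhds.congr' ?_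
      filter_upwards [hω.2.eventually_ge_atTop t] with m hm
      rw [min_eq_right ((min_le_right _ _).trans hm), min_eq_right ((min_le_right _ _).trans hm),
        maxmin (fun u => X u ω) _ hst, min_eq_left hst]
      by_cases h1 : ω ∈ A <;> simp [h1]
      ring
  simp_rw [hz] at hlim
  exact (tendsto_nhds_unique hlim tendsto_const_nhds)

end mart

end PathwiseSuperhedging

namespace PathwiseSuperhedging

section lemE
variable {E : Type*} [mE : MeasurableSpace E] {P : Measure E}
  {F : ℝ → MeasurableSpace E} {T : ℝ} {X A : ℝ → E → ℝ}

lemma sq_int [IsProbabilityMeasure P] (hle : ∀ t, F t ≤ mE)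
    {g : E → ℝ} {t : ℝ} (hg : Measurable[F t] g) {B : ℝ} (hB : ∀ᵐ ω ∂P, |g ω| ≤ B) :
    Integrable (fun ω => g ω ^ 2) P := by
  refine Integrable.of_bound ((hg.pow_const 2).mono (hle t) le_rfl).aestronglyMeasurable (B ^ 2) ?_
  filter_upwards [hB] with ω hω
  rw [norm_pow]
  exact pow_le_pow_left₀ (norm_nonneg _) hω 2

lemma ortho_step [IsProbabilityMeasure P] (hle : ∀ t, F t ≤ mE) (hX : CA F T X)
    (hM : Mart P F T X) {B : ℝ} (hB : ∀ᵐ ω ∂P, ∀ t ∈ Icc (0:ℝ) T, |X t ω| ≤ B) {s t : ℝ}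
    (hs : s ∈ Icc (0:ℝ) T) (ht : t ∈ Icc (0:ℝ) T) (hst : s ≤ t) :
    Integrable (fun ω => (X t ω - X s ω) ^ 2) P ∧
    ∫ ω, (X t ω - X s ω) ^ 2 ∂P = ∫ ω, X t ω ^ 2 ∂P - ∫ ω, X s ω ^ 2 ∂P := by
  have it := sq_int hle (hX.adapted t ht) (hB.mono fun ω h => h t ht)
  have is := sq_int hle (hX.adapted s hs) (hB.mono fun ω h => h s hs)
  obtain ⟨i1, i2⟩ := mean_zero hle hM hs ht hst (hX.adapted s hs) (hB.mono fun ω h => h s hs)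
  have e : ∀ ω, (X t ω - X s ω) ^ 2 = (X t ω ^ 2 - X s ω ^ 2) - 2 * (X s ω * (X t ω - X s ω)) := by
    intro ω; ring
  simp_rw [e]
  refine ⟨(it.sub is).sub (i1.const_mul 2), ?_⟩
  have e3 : ∫ ω, (X t ω ^ 2 - X s ω ^ 2) - 2 * (X s ω * (X t ω - X s ω)) ∂P
      = ∫ ω, (X t ω ^ 2 - X s ω ^ 2) ∂P - ∫ ω, 2 * (X s ω * (X t ω - X s ω)) ∂P :=
    integral_sub (it.sub is) (i1.const_mul 2)
  rw [e3, integral_sub it is, integral_const_mul, i2]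
  ring

lemma ortho_sum [IsProbabilityMeasure P] (hT : 0 ≤ T) (hle : ∀ t, F t ≤ mE) (hX : CA F T X)
    (hM : Mart P F T X) {B : ℝ} (hB : ∀ᵐ ω ∂P, ∀ t ∈ Icc (0:ℝ) T, |X t ω| ≤ B)
    (h0 : ∀ᵐ ω ∂P, X 0 ω = 0) (N : ℕ) :
    (∀ i ∈ Finset.range (N + 1), Integrable (fun ω => (X (gp T N (i+1)) ω - X (gp T N i) ω) ^ 2) P) ∧
    ∑ i ∈ Finset.range (N + 1), ∫ ω, (X (gp T N (i+1)) ω - X (gp T N i) ω) ^ 2 ∂P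
      = ∫ ω, X T ω ^ 2 ∂P := by
  have hTT : T ∈ Icc (0:ℝ) T := ⟨hT, le_rfl⟩
  have st : ∀ i ∈ Finset.range (N + 1), _ := fun i hi => by
    rw [Finset.mem_range] at hi
    exact ortho_step hle hX hM hB (gp_mem hTT (show i ≤ N + 1 by omega))
      (gp_mem hTT (show i + 1 ≤ N + 1 by omega)) (gp_mono hT (by omega))
  refine ⟨fun i hi => (st i hi).1, ?_⟩
  rw [Finset.sum_congr rfl fun i hi => (st i hi).2,
    Finset.sum_range_sub (fun i => ∫ ω, X (gp T N i) ω ^ 2 ∂P), gp_last, gp_zero]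
  have : ∫ ω, X 0 ω ^ 2 ∂P = 0 := by
    refine integral_eq_zero_of_ae ?_
    filter_upwards [h0] with ω hω
    rw [hω]; simp
  rw [this, sub_zero]

lemma qsum_le {f : ℝ → ℝ} (hT : 0 ≤ T) (hm : MonotoneOn f (Icc 0 T)) (h0 : f 0 = 0) {η : ℝ} {N : ℕ}
    (hη : ∀ i ∈ Finset.range (N + 1), f (gp T N (i+1)) - f (gp T N i) ≤ η) :
    ∑ i ∈ Finset.range (N + 1), (f (gp T N (i+1)) - f (gp T N i)) ^ 2 ≤ η * f T := by
  have hTT : T ∈ Icc (0:ℝ) T := ⟨hT, le_rfl⟩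
  have e : f T = ∑ i ∈ Finset.range (N + 1), (f (gp T N (i+1)) - f (gp T N i)) := by
    rw [Finset.sum_range_sub (fun i => f (gp T N i)), gp_last, gp_zero, h0, sub_zero]
  rw [e, Finset.mul_sum]
  refine Finset.sum_le_sum fun i hi => ?_
  have h1 := hη i hi
  rw [Finset.mem_range] at hi
  have h2 := hm (gp_mem hTT (show i ≤ N + 1 by omega))
      (gp_mem hTT (show i + 1 ≤ N + 1 by omega)) (gp_mono hT (by omega))
  nlinarith

lemma qsum_tendsto {f : ℝ → ℝ} (hT : 0 ≤ T) (hm : MonotoneOn f (Icc 0 T)) (h0 : f 0 = 0)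
    (hf : Continuous f) :
    Tendsto (fun N : ℕ => ∑ i ∈ Finset.range (N + 1), (f (gp T N (i+1)) - f (gp T N i)) ^ 2)
      atTop (𝓝 0) := by
  have hTT : T ∈ Icc (0:ℝ) T := ⟨hT, le_rfl⟩
  have hu := isCompact_Icc.uniformContinuousOn_of_continuous (s := Icc 0 T) hf.continuousOn
  rw [Metric.uniformContinuousOn_iff] at hu
  rw [Metric.tendsto_atTop]
  intro ε hε
  have hfT : 0 ≤ f T := by rw [← h0]; exact hm ⟨le_rfl, hT⟩ hTT hT
  obtain ⟨δ, hδ, hu⟩ := hu (ε / (f T + 1)) (by positivity)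
  obtain ⟨M, hM⟩ := exists_nat_gt (T / δ)
  refine ⟨M, fun N hN => ?_⟩
  rw [Real.dist_eq, sub_zero, abs_of_nonneg (Finset.sum_nonneg fun _ _ => sq_nonneg _)]
  refine lt_of_le_of_lt (qsum_le hT hm h0 (η := ε / (f T + 1)) ?_) ?_
  · intro i hi
    rw [Finset.mem_range] at hi
    have := hu _ (gp_mem hTT (show i + 1 ≤ N + 1 by omega)) _ (gp_mem hTT (show i ≤ N + 1 by omega)) ?_
    · rw [Real.dist_eq] at this
      exact (le_abs_self _).trans this.le
    · have e : gp T N (i+1) - gp T N i = T / (N + 1) := by unfold gp; push_cast; ring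
      rw [Real.dist_eq, e, abs_of_nonneg (by positivity), div_lt_iff₀ (by positivity)]
      rw [div_lt_iff₀ hδ] at hM
      have : (M:ℝ) ≤ N := by exact_mod_cast hN
      nlinarith
  · rw [div_mul_eq_mul_div, div_lt_iff₀ (by positivity)]
    nlinarith

lemma lemE [IsProbabilityMeasure P] (hT : 0 ≤ T) (hle : ∀ t, F t ≤ mE) (hX : CA F T X)
    (hA : CA F T A) (hMX : Mart P F T X) (hMA : Mart P F T (fun t ω => X t ω * X t ω - A t ω))
    {ε C : ℝ} (hε : ∀ᵐ ω ∂P, ∀ t ∈ Icc (0:ℝ) T, |X t ω| ≤ ε)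
    (hmono : ∀ᵐ ω ∂P, MonotoneOn (fun t => A t ω) (Icc 0 T))
    (h0 : ∀ᵐ ω ∂P, X 0 ω = 0 ∧ A 0 ω = 0) (hC : ∀ᵐ ω ∂P, A T ω ≤ C) :
    ∫ ω, (X T ω * X T ω - A T ω) ^ 2 ∂P ≤ 8 * ε ^ 2 * ∫ ω, A T ω ∂P := by
  have hTT : T ∈ Icc (0:ℝ) T := ⟨hT, le_rfl⟩
  have h00 : (0:ℝ) ∈ Icc (0:ℝ) T := ⟨le_rfl, hT⟩
  have hAb : ∀ᵐ ω ∂P, ∀ t ∈ Icc (0:ℝ) T, 0 ≤ A t ω ∧ A t ω ≤ C := by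
    filter_upwards [hmono, h0, hC] with ω h1 h2 h3 t ht
    have := h1 h00 ht ht.1
    have := h1 ht hTT ht.2
    simp only [h2.2] at *
    constructor <;> linarith
  set M : ℝ → E → ℝ := fun t ω => X t ω * X t ω - A t ω with hMdef
  have hMca : CA F T M := (hX.mul hX).sub hA
  have hMb : ∀ᵐ ω ∂P, ∀ t ∈ Icc (0:ℝ) T, |M t ω| ≤ ε ^ 2 + C := by
    filter_upwards [hε, hAb] with ω h1 h2 t ht
    obtain ⟨h3, h4⟩ := h2 t ht
    have h5 := sq_le_sq' (abs_le.1 (h1 t ht)).1 (abs_le.1 (h1 t ht)).2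
    simp only [hMdef]
    rw [abs_le]
    constructor <;> nlinarith [sq_nonneg (X t ω)]
  have hXA : ∫ ω, X T ω ^ 2 ∂P = ∫ ω, A T ω ∂P := by
    have := hMA.2 0 T h00 hTT hT univ (@MeasurableSet.univ _ (F 0))
    simp only [Measure.restrict_univ] at this
    have e0 : ∫ ω, M 0 ω ∂P = 0 := by
      refine integral_eq_zero_of_ae ?_
      filter_upwards [h0] with ω hω
      simp [hMdef, hω.1, hω.2]
    have i1 := sq_int hle (hX.adapted T hTT) (hε.mono fun ω h => h T hTT)
    have i2 : Integrable (A T) P := by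
      refine (i1.sub (hMA.1 T hTT)).congr (ae_of_all _ fun ω => ?_)
      simp [hMdef]; ring
    have e1 : ∫ ω, M T ω ∂P = ∫ ω, X T ω ^ 2 ∂P - ∫ ω, A T ω ∂P := by
      rw [← integral_sub i1 i2]
      congr 1; ext ω; simp [hMdef]; ring
    have : ∫ ω, M T ω ∂P = 0 := by rw [← e0]; exact this
    linarith
  have hN : ∀ N : ℕ, ∫ ω, (M T ω) ^ 2 ∂P ≤ 8 * ε ^ 2 * ∫ ω, A T ω ∂P + 2 *
      ∫ ω, ∑ i ∈ Finset.range (N + 1), (A (gp T N (i+1)) ω - A (gp T N i) ω) ^ 2 ∂P := by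
    intro N
    obtain ⟨j1, j2⟩ := ortho_sum hT hle hMca hMA hMb
      (h0.mono fun ω h => by simp [hMdef, h.1, h.2]) N
    obtain ⟨k1, k2⟩ := ortho_sum hT hle hX hMX hε (h0.mono fun ω h => h.1) N
    have l1 : ∀ i ∈ Finset.range (N + 1),
        Integrable (fun ω => (A (gp T N (i+1)) ω - A (gp T N i) ω) ^ 2) P := by
      intro i hi
      rw [Finset.mem_range] at hi
      have m1 := gp_mem hTT (show i + 1 ≤ N + 1 by omega)
      have m2 := gp_mem hTT (show i ≤ N + 1 by omega)
      refine Integrable.of_bound ((((hA.adapted _ m1).mono (hle _) le_rfl).sub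
        ((hA.adapted _ m2).mono (hle _) le_rfl)).pow_const 2).aestronglyMeasurable (C ^ 2) ?_
      filter_upwards [hAb] with ω hω
      rw [norm_pow]
      refine pow_le_pow_left₀ (norm_nonneg _) ?_ 2
      have := hω _ m1
      have := hω _ m2
      simp only [Real.norm_eq_abs]
      rw [abs_le]
      constructor <;> simp <;> linarith
    rw [← j2, ← hXA, ← k2, integral_finsetSum _ l1, Finset.mul_sum, Finset.mul_sum,
      ← Finset.sum_add_distrib]
    refine Finset.sum_le_sum fun i hi => ?_
    rw [← integral_const_mul, ← integral_const_mul, ← integral_add ((k1 i hi).const_mul _)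
      ((l1 i hi).const_mul _)]
    refine integral_mono_ae (j1 i hi) (((k1 i hi).const_mul _).add ((l1 i hi).const_mul _)) ?_
    rw [Finset.mem_range] at hi
    have m1 := gp_mem hTT (show i + 1 ≤ N + 1 by omega)
    have m2 := gp_mem hTT (show i ≤ N + 1 by omega)
    filter_upwards [hε] with ω hω
    have b1 := abs_le.1 (hω _ m1)
    have b2 := abs_le.1 (hω _ m2)
    simp only [hMdef]
    set x := X (gp T N (i+1)) ω
    set y := X (gp T N i) ω
    set p := A (gp T N (i+1)) ω
    set q := A (gp T N i) ω
    have h1 : (x + y) ^ 2 ≤ 4 * ε ^ 2 := by nlinarith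
    have h2 : (x + y) ^ 2 * (x - y) ^ 2 ≤ 4 * ε ^ 2 * (x - y) ^ 2 :=
      mul_le_mul_of_nonneg_right h1 (sq_nonneg _)
    show (x * x - p - (y * y - q)) ^ 2 ≤ 8 * ε ^ 2 * (x - y) ^ 2 + 2 * (p - q) ^ 2
    nlinarith [sq_nonneg ((x + y) * (x - y) + (p - q))]
  have hlim : Tendsto (fun N : ℕ => ∫ ω, ∑ i ∈ Finset.range (N + 1),
      (A (gp T N (i+1)) ω - A (gp T N i) ω) ^ 2 ∂P) atTop (𝓝 (∫ ω, (0:ℝ) ∂P)) := by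
    refine tendsto_integral_of_dominated_convergence (fun _ => C * C) (fun N => ?_)
      (integrable_const _) (fun N => ?_) ?_
    · refine (Finset.measurable_fun_sum _ fun i hi => ?_).aestronglyMeasurable
      rw [Finset.mem_range] at hi
      have m1 := gp_mem hTT (show i + 1 ≤ N + 1 by omega)
      have m2 := gp_mem hTT (show i ≤ N + 1 by omega)
      exact (((hA.adapted _ m1).mono (hle _) le_rfl).sub
        ((hA.adapted _ m2).mono (hle _) le_rfl)).pow_const 2
    · filter_upwards [hmono, h0, hAb] with ω h1 h2 h3
      rw [Real.norm_eq_abs, abs_of_nonneg (Finset.sum_nonneg fun _ _ => sq_nonneg _)]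
      have h4 := h3 T hTT
      refine (qsum_le (f := fun t => A t ω) hT h1 h2.2 (η := C) ?_).trans ?_
      · intro i hi
        rw [Finset.mem_range] at hi
        have := h3 _ (gp_mem hTT (show i + 1 ≤ N + 1 by omega))
        have := h3 _ (gp_mem hTT (show i ≤ N + 1 by omega))
        show A _ ω - A _ ω ≤ C
        linarith
      · exact mul_le_mul_of_nonneg_left h4.2 (h4.1.trans h4.2)
    · filter_upwards [hmono, h0] with ω h1 h2
      exact qsum_tendsto (f := fun t => A t ω) hT h1 h2.2 (hA.cont ω)
  simp only [integral_zero] at hlim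
  have := (hlim.const_mul 2).const_add (8 * ε ^ 2 * ∫ ω, A T ω ∂P)
  simp only [mul_zero, add_zero] at this
  exact ge_of_tendsto' this hN
end lemE

end PathwiseSuperhedging

namespace PathwiseSuperhedging

section paths
variable {T : ℝ} (hT : 0 ≤ T)

lemma Fraw_mono : Monotone (Fraw T) := fun s t hst =>
  iSup_mono fun _ => iSup_mono' fun h => ⟨h.trans hst, le_rfl⟩

lemma Fraw_le (t : ℝ) : Fraw T t ≤ (inferInstance : MeasurableSpace (Path T)) := by
  refine iSup_le fun s => iSup_le fun _ => ?_
  rw [← measurable_iff_comap_le]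
  exact (continuous_eval_const (F := Path T) s).measurable

lemma FbarRaw_mono : Monotone (FbarRaw T) := fun s t hst =>
  iSup_mono fun _ => iSup_mono' fun h => ⟨h.trans hst, le_rfl⟩

lemma FbarRaw_le (t : ℝ) : FbarRaw T t ≤ (inferInstance : MeasurableSpace (PathPair T)) := by
  refine iSup_le fun s => iSup_le fun _ => ?_
  rw [← measurable_iff_comap_le]
  have h := (continuous_eval_const (F := Path T) s).measurable
  exact (h.comp measurable_fst).prodMk (h.comp measurable_snd)

lemma clamp_of_mem {t : ℝ} (ht : t ∈ Icc (0:ℝ) T) : clamp T hT t = ⟨t, ht⟩ := projIcc_of_mem hT ht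

lemma ev_cont (ω : Path T) : Continuous (ev T hT ω) := ω.continuous.comp (continuous_projIcc (h := hT))

lemma ev_neg (ω : Path T) {t : ℝ} (ht : t ≤ 0) : ev T hT ω t = ev T hT ω 0 := by
  unfold ev clamp
  rw [projIcc_of_le_left hT ht, projIcc_of_le_left hT le_rfl]

lemma ev_top (ω : Path T) {t : ℝ} (ht : T ≤ t) : ev T hT ω t = ev T hT ω T := by
  unfold ev clamp
  rw [projIcc_of_right_le hT ht, projIcc_of_right_le hT le_rfl]

lemma ev_CA : CA (Fraw T) T (fun t ω => ev T hT ω t) where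
  cont := ev_cont hT
  adapted t ht := by
    have : Measurable[Fraw T t] (fun ω : Path T => ω ⟨t, ht⟩) := by
      rw [measurable_iff_comap_le]
      exact le_iSup₂_of_le (f := fun (s : Icc (0:ℝ) T) (_ : (s:ℝ) ≤ t) =>
        MeasurableSpace.comap (fun ω : Path T => ω s) inferInstance) ⟨t, ht⟩ le_rfl le_rfl
    convert this using 2 with ω
    unfold ev; rw [clamp_of_mem hT ht]
  neg t ht ω := ev_neg hT ω ht

lemma evb_meas {t : ℝ} (ht : t ∈ Icc (0:ℝ) T) :
    Measurable[FbarRaw T t] (fun p : PathPair T => (p.1 ⟨t, ht⟩, p.2 ⟨t, ht⟩)) := by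
  rw [measurable_iff_comap_le]
  exact le_iSup₂_of_le (f := fun (s : Icc (0:ℝ) T) (_ : (s:ℝ) ≤ t) =>
    MeasurableSpace.comap (fun p : PathPair T => (p.1 s, p.2 s)) inferInstance) ⟨t, ht⟩ le_rfl le_rfl

lemma V_CA : CA (FbarRaw T) T (VbarProc T hT) where
  cont p := ev_cont hT p.2
  adapted t ht := by
    have := measurable_snd.comp (evb_meas ht)
    convert this using 1
    ext p
    simp [VbarProc, ev, clamp_of_mem hT ht]
  neg t ht ω := ev_neg hT _ ht

lemma fst_meas (t : ℝ) : Measurable[FbarRaw T t, Fraw T t] (Prod.fst : PathPair T → Path T) := by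
  rw [measurable_iff_comap_le]
  unfold Fraw
  simp only [MeasurableSpace.comap_iSup, MeasurableSpace.comap_comp]
  refine iSup_le fun s => iSup_le fun hs => ?_
  rw [← measurable_iff_comap_le]
  exact (measurable_fst.comp (evb_meas s.2)).mono (FbarRaw_mono hs) le_rfl

lemma CA.lift {X : ℝ → Path T → ℝ} (hX : CA (Fraw T) T X) :
    CA (FbarRaw T) T (fun t p => X t p.1) where
  cont p := hX.cont p.1
  adapted t ht := (hX.adapted t ht).comp (fst_meas t)
  neg t ht p := hX.neg t ht p.1

lemma Stop.lift {τ : Path T → ℝ} (hτ : Stop (Fraw T) T τ) :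
    Stop (FbarRaw T) T (fun p => τ p.1) := fun t ht => fst_meas t (hτ t ht)

lemma S_CA : CA (FbarRaw T) T (SbarProc T hT) := (ev_CA hT).lift

/-! sig -/
variable (m : ℕ)

lemma sig_hit (k : ℕ) (ω : Path T) : sig T hT m (k + 1) ω = hit T ((2:ℝ) ^ (-(m:ℤ))) (T + 1)
    (fun t ω => |ev T hT ω t - ev T hT ω (min (sig T hT m k ω) t)|) ω := by
  have hp : (0:ℝ) < (2:ℝ) ^ (-(m:ℤ)) := by positivity
  have hk : 0 ≤ sig T hT m k ω := by
    cases k with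
    | zero => simp [sig]
    | succ k =>
      refine Real.sInf_nonneg ?_
      have : ∀ k, 0 ≤ sig T hT m k ω := by
        intro k
        induction k with
        | zero => simp [sig]
        | succ k ih =>
          refine Real.sInf_nonneg ?_
          rintro x (hx | hx)
          · exact ih.trans hx.1
          · rw [mem_singleton_iff.1 hx]; linarith
      rintro x (hx | hx)
      · exact (this k).trans hx.1
      · rw [mem_singleton_iff.1 hx]; linarith
  unfold hit
  rw [sig]
  refine congrArg sInf (congrArg (· ∪ {T + 1}) ?_)
  ext t
  simp only [mem_ofPred_eq]
  constructor
  · rintro ⟨h1, h2, h3⟩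
    exact ⟨hk.trans h1, h2, by rwa [min_eq_left h1]⟩
  · rintro ⟨h1, h2, h3⟩
    rcases le_total (sig T hT m k ω) t with h4 | h4
    · exact ⟨h4, h2, by rwa [min_eq_left h4] at h3⟩
    · rw [min_eq_right h4] at h3; rw [sub_self, abs_zero] at h3; linarith

lemma sig_aux_cont (k : ℕ) (ω : Path T) :
    Continuous fun t => |ev T hT ω t - ev T hT ω (min (sig T hT m k ω) t)| :=
  ((ev_cont hT ω).sub ((ev_cont hT ω).comp (continuous_const.min continuous_id))).abs

lemma sig_stop (k : ℕ) : Stop (Fraw T) T (sig T hT m k) := by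
  induction k with
  | zero => exact Stop.const 0
  | succ k ih =>
    rw [show sig T hT m (k+1) = _ from funext (sig_hit hT m k)]
    exact hit_stop Fraw_mono (by linarith)
      (((ev_CA hT).sub ((ev_CA hT).stopped Fraw_mono ih)).comp continuous_abs)

lemma sig_nonneg (k : ℕ) (ω : Path T) : 0 ≤ sig T hT m k ω := by
  cases k with
  | zero => simp [sig]
  | succ k =>
    rw [sig_hit]
    exact hit_nonneg (Y := fun t ω => |ev T hT ω t - ev T hT ω (min (sig T hT m k ω) t)|) hT (by linarith) (sig_aux_cont hT m k ω)

lemma sig_cases (k : ℕ) (ω : Path T) :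
    (sig T hT m (k+1) ω = T + 1 ∧
      ∀ t, sig T hT m k ω ≤ t → t ≤ T → |ev T hT ω t - ev T hT ω (sig T hT m k ω)| < (2:ℝ) ^ (-(m:ℤ)))
    ∨ (sig T hT m k ω ≤ sig T hT m (k+1) ω ∧ sig T hT m (k+1) ω ≤ T ∧
      (2:ℝ) ^ (-(m:ℤ)) ≤ |ev T hT ω (sig T hT m (k+1) ω) - ev T hT ω (sig T hT m k ω)|) := by
  have hp : (0:ℝ) < (2:ℝ) ^ (-(m:ℤ)) := by positivity
  have h := hit_cases (Y := fun t ω => |ev T hT ω t - ev T hT ω (min (sig T hT m k ω) t)|) (T := T) (d := T+1) (c := (2:ℝ) ^ (-(m:ℤ))) (by linarith) (sig_aux_cont hT m k ω)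
  rw [← sig_hit] at h
  rcases h with h | h
  · left
    refine ⟨h.1, fun t h1 h2 => ?_⟩
    have := h.2 t ((sig_nonneg hT m k ω).trans h1) h2
    rwa [min_eq_left h1] at this
  · right
    rcases le_total (sig T hT m k ω) (sig T hT m (k+1) ω) with h4 | h4
    · exact ⟨h4, h.2.1, by have := h.2.2.1; rwa [min_eq_left h4] at this⟩
    · have := h.2.2.1
      rw [min_eq_right h4] at this; rw [sub_self, abs_zero] at this; linarith

lemma sig_le_top (k : ℕ) (ω : Path T) : sig T hT m k ω ≤ T + 1 := by
  cases k with
  | zero => simp [sig]; linarith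
  | succ k =>
    rcases sig_cases hT m k ω with h | h
    · exact h.1.le
    · linarith [h.2.1]

lemma sig_succ_le (k : ℕ) (ω : Path T) : sig T hT m k ω ≤ sig T hT m (k+1) ω := by
  rcases sig_cases hT m k ω with h | h
  · rw [h.1]; exact sig_le_top hT m k ω
  · exact h.1

lemma sig_mono (ω : Path T) : Monotone fun k => sig T hT m k ω :=
  monotone_nat_of_le_succ fun k => sig_succ_le hT m k ω

lemma sig_osc (k : ℕ) (ω : Path T) {t : ℝ} (h1 : sig T hT m k ω ≤ t) (h2 : t ≤ sig T hT m (k+1) ω)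
    (h3 : t ≤ T) : |ev T hT ω t - ev T hT ω (sig T hT m k ω)| ≤ (2:ℝ) ^ (-(m:ℤ)) := by
  have hp : (0:ℝ) < (2:ℝ) ^ (-(m:ℤ)) := by positivity
  have h0 := (sig_nonneg hT m k ω).trans h1
  rw [sig_hit] at h2
  have := hit_le (Y := fun t ω => |ev T hT ω t - ev T hT ω (min (sig T hT m k ω) t)|) (by linarith) (sig_aux_cont hT m k ω) h0 h3 h2
  rw [min_eq_left h1] at this
  refine this.trans (max_le le_rfl ?_)
  rw [min_eq_right (sig_nonneg hT m k ω)]; simp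

lemma sig_eventually (ω : Path T) : ∃ K, ∀ k ≥ K, sig T hT m k ω = T + 1 := by
  have hp : (0:ℝ) < (2:ℝ) ^ (-(m:ℤ)) := by positivity
  have hu := isCompact_Icc.uniformContinuousOn_of_continuous (s := Icc 0 T) (ev_cont hT ω).continuousOn
  rw [Metric.uniformContinuousOn_iff] at hu
  obtain ⟨δ, hδ, hu⟩ := hu _ hp
  by_cases hK : ∃ K, T < sig T hT m K ω
  · obtain ⟨K, hK⟩ := hK
    cases K with
    | zero => simp [sig] at hK; linarith
    | succ K =>
      have e : sig T hT m (K+1) ω = T + 1 := by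
        rcases sig_cases hT m K ω with h | h
        · exact h.1
        · linarith [h.2.1]
      exact ⟨K+1, fun k hk => le_antisymm (sig_le_top hT m k ω) (e ▸ sig_mono hT m ω hk)⟩
  · push Not at hK
    exfalso
    have : ∀ k : ℕ, k * δ ≤ sig T hT m k ω := by
      intro k
      induction k with
      | zero => simp [sig]
      | succ k ih =>
        rcases sig_cases hT m k ω with h | h
        · linarith [hK (k+1), h.1]
        · by_contra hc
          push Not at hc
          push_cast at hc
          have := hu _ ⟨sig_nonneg hT m (k+1) ω, hK (k+1)⟩ _ ⟨sig_nonneg hT m k ω, hK k⟩ (by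
            rw [Real.dist_eq, abs_of_nonneg (by linarith [h.1])]; linarith)
          rw [Real.dist_eq] at this
          linarith [h.2.2]
    obtain ⟨k, hk⟩ := exists_nat_gt (T / δ)
    rw [div_lt_iff₀ hδ] at hk
    linarith [this k, hK k]

def PS (K : ℕ) (t : ℝ) (ω : Path T) : ℝ := ∑ k ∈ Finset.range K, ev T hT ω (sig T hT m k ω) *
    (ev T hT ω (min (sig T hT m (k + 1) ω) t) - ev T hT ω (min (sig T hT m k ω) t))

lemma PS_eq (K : ℕ) (t : ℝ) (ω : Path T) :
    PS hT m K t ω = Sm T hT m (min (sig T hT m K ω) t) ω := by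
  unfold Sm PS
  rw [tsum_eq_sum (s := Finset.range K)]
  · refine Finset.sum_congr rfl fun k hk => ?_
    rw [Finset.mem_range] at hk
    rw [← min_assoc, ← min_assoc, min_eq_left (sig_mono hT m ω hk), min_eq_left (sig_mono hT m ω hk.le)]
  · intro k hk
    rw [Finset.mem_range, not_lt] at hk
    rw [← min_assoc, ← min_assoc, min_eq_right (sig_mono hT m ω hk),
      min_eq_right (sig_mono hT m ω (hk.trans k.le_succ))]
    simp

lemma Sm_eq_PS {K : ℕ} {ω : Path T} (h : ∀ k ≥ K, sig T hT m k ω = T + 1) (t : ℝ) :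
    Sm T hT m t ω = PS hT m K t ω := by
  unfold Sm PS
  rw [tsum_eq_sum (s := Finset.range K)]
  intro k hk
  rw [Finset.mem_range, not_lt] at hk
  rw [h k hk, h (k+1) (by omega)]
  simp

lemma PS_CA (K : ℕ) : CA (Fraw T) T (PS hT m K) :=
  CA.sum _ fun k => SI_CA Fraw_mono (ev_CA hT) (sig_stop hT m k) (sig_stop hT m (k+1))
    (sig_succ_le hT m k) (MeasAt.of_stopped Fraw_mono (ev_CA hT) (sig_stop hT m k))

lemma Sm_CA : CA (Fraw T) T (Sm T hT m) where
  cont ω := by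
    obtain ⟨K, hK⟩ := sig_eventually hT m ω
    simp_rw [Sm_eq_PS hT m hK]
    exact (PS_CA hT m K).cont ω
  adapted t ht := by
    refine @measurable_of_tendsto_metrizable _ ℝ (Fraw T t) _ _ _ _ (fun K => PS hT m K t) _
      (fun K => (PS_CA hT m K).adapted t ht) ?_
    rw [tendsto_pi_nhds]
    intro ω
    obtain ⟨K, hK⟩ := sig_eventually hT m ω
    refine tendsto_const_nhds.congr' ?_
    filter_upwards [eventually_ge_atTop K] with k hk
    exact Sm_eq_PS hT m (fun j hj => hK j (hk.trans hj)) t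
  neg t ht ω := by
    obtain ⟨K, hK⟩ := sig_eventually hT m ω
    simp_rw [Sm_eq_PS hT m hK]
    exact (PS_CA hT m K).neg t ht ω

lemma Sm_zero (ω : Path T) : Sm T hT m 0 ω = 0 := by
  unfold Sm
  simp [min_eq_right (sig_nonneg hT m _ ω)]

lemma Sm_top (ω : Path T) {t : ℝ} (ht : T ≤ t) : Sm T hT m t ω = Sm T hT m T ω := by
  unfold Sm
  congr 1
  ext k
  have : ∀ x, ev T hT ω (min x t) = ev T hT ω (min x T) := by
    intro x
    rcases le_total x T with h | h
    · rw [min_eq_left h, min_eq_left (h.trans ht)]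
    · rw [min_eq_right h, ev_top hT ω (le_min h ht)]
  rw [this, this]

end paths
end PathwiseSuperhedging

namespace PathwiseSuperhedging

section core
variable {T : ℝ} (hT : 0 ≤ T)

lemma I_CA : CA (FbarRaw T) T (SSbarProc T hT) := by
  have := (((((S_CA hT).mul (S_CA hT)).sub (((S_CA hT).init FbarRaw_mono).mul
    ((S_CA hT).init FbarRaw_mono))).sub (V_CA hT)).mul (CA.const (1/2)))
  convert this using 1
  ext t p
  simp [SSbarProc, SbarProc, VbarProc]; ring

lemma I_eq (t : ℝ) (p : PathPair T) : SSbarProc T hT t p =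
    ((SbarProc T hT t p) ^ 2 - (SbarProc T hT 0 p) ^ 2 - VbarProc T hT t p) / 2 := rfl

def rho (n : ℕ) : PathPair T → ℝ :=
  hit T n (T + 1 + n) (fun t p => |SbarProc T hT t p| + |VbarProc T hT t p|)

lemma rho_Y_CA : CA (FbarRaw T) T (fun t p => |SbarProc T hT t p| + |VbarProc T hT t p|) :=
  ((S_CA hT).comp continuous_abs).add ((V_CA hT).comp continuous_abs)

lemma rho_lt (n : ℕ) : T < T + 1 + n := by
  have : (0:ℝ) ≤ n := Nat.cast_nonneg n
  linarith

lemma rho_stop (n : ℕ) : Stop (FbarRaw T) T (rho hT n) :=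
  hit_stop FbarRaw_mono (rho_lt n) (rho_Y_CA hT)

lemma rho_nonneg (n : ℕ) (p : PathPair T) : 0 ≤ rho hT n p :=
  hit_nonneg hT (rho_lt n) ((rho_Y_CA hT).cont p)

lemma rho_dich (n : ℕ) (p : PathPair T) : rho hT n p = 0 ∨
    ∀ t, 0 ≤ t → t ≤ T → t ≤ rho hT n p → |SbarProc T hT t p| + |VbarProc T hT t p| ≤ n := by
  rcases lt_or_ge (|SbarProc T hT 0 p| + |VbarProc T hT 0 p|) n with h | h
  · right
    intro t h0 h1 h2
    exact (hit_le (Y := fun t p => |SbarProc T hT t p| + |VbarProc T hT t p|) (rho_lt n) ((rho_Y_CA hT).cont p) h0 h1 h2).trans (max_le le_rfl h.le)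
  · left
    rcases hit_cases (c := n) (Y := fun t p => |SbarProc T hT t p| + |VbarProc T hT t p|) (rho_lt n) ((rho_Y_CA hT).cont p) with h1 | h1
    · exact absurd (h1.2 0 le_rfl hT) (not_lt.2 h)
    · refine le_antisymm ?_ h1.1
      by_contra h2
      push Not at h2
      exact absurd (h1.2.2.2 0 le_rfl h2) (not_lt.2 h)

lemma hit_mono {E : Type*} {c d c' d' : ℝ} (hc : c ≤ c') (hd : T < d) (hdd : d ≤ d') {Y : ℝ → E → ℝ}
    {ω : E} (hY : Continuous fun t => Y t ω) : hit T c d Y ω ≤ hit T c' d' Y ω := by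
  rcases hit_cases (c := c') (hd.trans_le hdd) hY with h | h
  · rw [h.1]
    rcases hit_cases (c := c) hd hY with h1 | h1
    · rw [h1.1]; exact hdd
    · linarith [h1.2.1]
  · by_contra h2
    push Not at h2
    rcases hit_cases (c := c) hd hY with h1 | h1
    · exact absurd (h1.2 _ h.1 h.2.1) (not_lt.2 (hc.trans h.2.2.1))
    · exact absurd (h1.2.2.2 _ h.1 h2) (not_lt.2 (hc.trans h.2.2.1))

lemma hit_n_eventually {E : Type*} {Y : ℝ → E → ℝ} {ω : E} (hY : Continuous fun t => Y t ω) :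
    ∃ n0 : ℕ, ∀ n ≥ n0, hit T n (T + 1 + n) Y ω = T + 1 + n := by
  obtain ⟨C, hC⟩ := isCompact_Icc.exists_bound_of_continuousOn (s := Icc 0 T) hY.continuousOn
  obtain ⟨n0, hn0⟩ := exists_nat_gt C
  refine ⟨n0, fun n hn => hit_gt (rho_lt n) hY fun t h0 h1 => ?_⟩
  have h3 := (le_abs_self _).trans (hC t ⟨h0, h1⟩)
  have : (n0:ℝ) ≤ n := by exact_mod_cast hn
  linarith

lemma hit_n_good {E : Type*} {Y : ℝ → E → ℝ} {ω : E} (hY : Continuous fun t => Y t ω) :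
    Monotone (fun n : ℕ => hit T n (T + 1 + n) Y ω) ∧
    Tendsto (fun n : ℕ => hit T n (T + 1 + n) Y ω) atTop atTop := by
  constructor
  · intro a b hab
    have : (a:ℝ) ≤ b := by exact_mod_cast hab
    exact hit_mono this (rho_lt a) (by linarith) hY
  · obtain ⟨n0, hn0⟩ := hit_n_eventually (T := T) hY
    have : Tendsto (fun n : ℕ => T + 1 + (n:ℝ)) atTop atTop :=
      tendsto_atTop_add_const_left _ _ tendsto_natCast_atTop_atTop
    refine this.congr' ?_
    filter_upwards [eventually_ge_atTop n0] with n hn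
    exact (hn0 n hn).symm

lemma inc_bd {n : ℕ} {p : PathPair T} {r : ℝ} (hr0 : 0 ≤ r) (hr : r ≤ rho hT n p) :
    ∀ t ∈ Icc (0:ℝ) T, |SbarProc T hT (min r t) p - SbarProc T hT 0 p| ≤ 2 * n ∧
      |SSbarProc T hT (min r t) p - SSbarProc T hT 0 p| ≤ n ^ 2 + n ∧
      |VbarProc T hT (min r t) p - VbarProc T hT 0 p| ≤ 2 * n := by
  intro t ht
  have hn : (0:ℝ) ≤ n := Nat.cast_nonneg n
  rcases rho_dich hT n p with h | h
  · have : r = 0 := by linarith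
    rw [this, min_eq_left ht.1]; simp; positivity
  · have h1 := h (min r t) (le_min hr0 ht.1) ((min_le_right _ _).trans ht.2) ((min_le_left _ _).trans hr)
    have h2 := h 0 le_rfl hT (hr0.trans hr)
    rw [I_eq, I_eq]
    set a := SbarProc T hT (min r t) p
    set b := SbarProc T hT 0 p
    set v := VbarProc T hT (min r t) p
    set w := VbarProc T hT 0 p
    have a1 : |a| ≤ n := by linarith [abs_nonneg v]
    have b1 : |b| ≤ n := by linarith [abs_nonneg w]
    have v1 : |v| ≤ n := by linarith [abs_nonneg a]
    have w1 : |w| ≤ n := by linarith [abs_nonneg b]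
    have a2 := sq_le_sq' (abs_le.1 a1).1 (abs_le.1 a1).2
    have b2 := sq_le_sq' (abs_le.1 b1).1 (abs_le.1 b1).2
    rw [abs_le] at a1 b1 v1 w1
    refine ⟨?_, ?_, ?_⟩ <;> rw [abs_le] <;> constructor <;>
      nlinarith [sq_nonneg a, sq_nonneg b, a1.1, a1.2, b1.1, b1.2, v1.1, v1.2, w1.1, w1.2]

def cl (n : ℕ) (x : ℝ) : ℝ := max (-n) (min n x)
lemma cl_cont (n : ℕ) : Continuous (cl n) := continuous_const.max (continuous_const.min continuous_id)
lemma cl_bd (n : ℕ) (x : ℝ) : |cl n x| ≤ n := by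
  have hn : (0:ℝ) ≤ n := Nat.cast_nonneg n
  unfold cl
  rw [abs_le]
  exact ⟨le_max_left _ _, max_le (by linarith) (min_le_left _ _)⟩
lemma cl_eq {n : ℕ} {x : ℝ} (h : |x| ≤ n) : cl n x = x := by
  rw [abs_le] at h
  unfold cl
  rw [min_eq_right h.2, max_eq_right h.1]

variable (m : ℕ)

lemma dich {n : ℕ} {p : PathPair T} {r : ℝ} (hr : r ≤ rho hT n p) (k : ℕ) {t : ℝ}
    (ht : t ≤ T) :
    (min r (min (sig T hT m (k+1) p.1) t) = min r (min (sig T hT m k p.1) t)) ∨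
    (min r (min (sig T hT m k p.1) t) = sig T hT m k p.1 ∧ sig T hT m k p.1 < min r t ∧
      cl n (SbarProc T hT (min (sig T hT m k p.1) r) p) = SbarProc T hT (sig T hT m k p.1) p) := by
  have hs := sig_succ_le hT m k p.1
  have hs0 := sig_nonneg hT m k p.1
  rcases le_or_gt (min r t) (sig T hT m k p.1) with h | h
  · left
    rw [min_left_comm, min_left_comm r, min_eq_right h, min_eq_right (h.trans hs)]
  · right
    have h1 := h.trans_le (min_le_left _ _)
    have h2 := h.trans_le (min_le_right _ _)
    rw [min_eq_left h2.le, min_eq_right h1.le, min_eq_left h1.le]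
    refine ⟨rfl, h, cl_eq ?_⟩
    rcases rho_dich hT n p with h3 | h3
    · linarith
    · have := h3 _ hs0 (by linarith) (by linarith)
      linarith [abs_nonneg (VbarProc T hT (sig T hT m k p.1) p)]

section withQ
variable {Q : Measure (PathPair T)} [IsProbabilityMeasure Q]
  (hS : LocMart Q (FbarRaw T) T (SbarProc T hT)) {n : ℕ} {r : PathPair T → ℝ}
  (hr : Stop (FbarRaw T) T r) (hr0 : ∀ p, 0 ≤ r p) (hrn : ∀ p, r p ≤ rho hT n p)

lemma Sr_mart (hS : LocMart Q (FbarRaw T) T (SbarProc T hT))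
  (hr : Stop (FbarRaw T) T r) (hr0 : ∀ p, 0 ≤ r p) (hrn : ∀ p, r p ≤ rho hT n p) :
    Mart Q (FbarRaw T) T (fun t p => SbarProc T hT (min (r p) t) p - SbarProc T hT 0 p) :=
  locmart_mart FbarRaw_le FbarRaw_mono (S_CA hT) hS hr (C := 2 * n)
    (ae_of_all _ fun p t ht => (inc_bd hT (hr0 p) (hrn p) t ht).1)

lemma Ir_mart (hI : LocMart Q (FbarRaw T) T (SSbarProc T hT))
  (hr : Stop (FbarRaw T) T r) (hr0 : ∀ p, 0 ≤ r p) (hrn : ∀ p, r p ≤ rho hT n p) :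
    Mart Q (FbarRaw T) T (fun t p => SSbarProc T hT (min (r p) t) p - SSbarProc T hT 0 p) :=
  locmart_mart FbarRaw_le FbarRaw_mono (I_CA hT) hI hr (C := n ^ 2 + n)
    (ae_of_all _ fun p t ht => (inc_bd hT (hr0 p) (hrn p) t ht).2.1)

lemma Sr_CA (hr : Stop (FbarRaw T) T r) :
    CA (FbarRaw T) T (fun t p => SbarProc T hT (min (r p) t) p - SbarProc T hT 0 p) :=
  ((S_CA hT).stopped FbarRaw_mono hr).sub ((S_CA hT).init FbarRaw_mono)

lemma Ir_CA (hr : Stop (FbarRaw T) T r) :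
    CA (FbarRaw T) T (fun t p => SSbarProc T hT (min (r p) t) p - SSbarProc T hT 0 p) :=
  ((I_CA hT).stopped FbarRaw_mono hr).sub ((I_CA hT).init FbarRaw_mono)

lemma sigb_stop (k : ℕ) : Stop (FbarRaw T) T (fun p => sig T hT m k p.1) := (sig_stop hT m k).lift

lemma cl_measAt (n k : ℕ) (hr : Stop (FbarRaw T) T r) : MeasAt (FbarRaw T) T (fun p => sig T hT m k p.1)
    (fun p => cl n (SbarProc T hT (min (sig T hT m k p.1) (r p)) p)) := by
  have hs := (sigb_stop hT m k).min hr
  exact MeasAt.mono (sigb_stop hT m k) (fun p => min_le_left _ _)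
    (MeasAt.comp hs (MeasAt.of_stopped FbarRaw_mono (S_CA hT) hs) (cl_cont n).measurable)

lemma PS_mart (hS : LocMart Q (FbarRaw T) T (SbarProc T hT))
  (hr : Stop (FbarRaw T) T r) (hr0 : ∀ p, 0 ≤ r p) (hrn : ∀ p, r p ≤ rho hT n p) (K : ℕ) :
    Mart Q (FbarRaw T) T (fun t p => PS hT m K (min (r p) t) p.1) := by
  refine (Mart.sum (Finset.range K) fun k => SI_Mart (P := Q) FbarRaw_le FbarRaw_mono (Sr_CA hT hr)
    (Sr_mart hT hS hr hr0 hrn) (sigb_stop hT m k) (sigb_stop hT m (k+1))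
    (fun p => sig_succ_le hT m k p.1) (cl_measAt hT m n k hr) (C := n)
    (ae_of_all _ fun p => cl_bd n _)).congr fun t ht => ae_of_all _ fun p => ?_
  show _ = PS hT m K (min (r p) t) p.1
  unfold PS
  refine Finset.sum_congr rfl fun k _ => ?_
  rw [min_left_comm _ (r p), min_left_comm _ (r p)]
  show cl n _ * _ = SbarProc T hT _ p * (SbarProc T hT _ p - SbarProc T hT _ p)
  rcases dich hT m (hrn p) k ht.2 with h | h
  · rw [h]; simp
  · rw [h.2.2]; ring
end withQ

end core
end PathwiseSuperhedging

namespace PathwiseSuperhedging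

section core2
variable {T : ℝ} (hT : 0 ≤ T) (m : ℕ)

def DD (t : ℝ) (p : PathPair T) : ℝ := Sm T hT m t p.1 - (SSbarProc T hT t p - SSbarProc T hT 0 p)

lemma DD_CA : CA (FbarRaw T) T (DD hT m) :=
  (Sm_CA hT m).lift.sub ((I_CA hT).sub ((I_CA hT).init FbarRaw_mono))

lemma DD_zero (p : PathPair T) : DD hT m 0 p = 0 := by simp [DD, Sm_zero]

lemma D_top (p : PathPair T) {t : ℝ} (ht : T ≤ t) : DD hT m t p = DD hT m T p := by
  simp [DD, Sm_top hT m p.1 ht, SSbarProc, ev_top hT _ ht]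

def XX (r : PathPair T → ℝ) (k : ℕ) (t : ℝ) (p : PathPair T) : ℝ :=
  SbarProc T hT (min (r p) (min (sig T hT m (k+1) p.1) t)) p -
    SbarProc T hT (min (r p) (min (sig T hT m k p.1) t)) p

def AA (r : PathPair T → ℝ) (k : ℕ) (t : ℝ) (p : PathPair T) : ℝ :=
  VbarProc T hT (min (r p) (min (sig T hT m (k+1) p.1) t)) p -
    VbarProc T hT (min (r p) (min (sig T hT m k p.1) t)) p

variable {Q : Measure (PathPair T)} [IsProbabilityMeasure Q] {n : ℕ} {r : PathPair T → ℝ}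

lemma incr_CA {Y : ℝ → PathPair T → ℝ} (hY : CA (FbarRaw T) T Y) (hr : Stop (FbarRaw T) T r) (k : ℕ) :
    CA (FbarRaw T) T (fun t p => Y (min (r p) (min (sig T hT m (k+1) p.1) t)) p -
    Y (min (r p) (min (sig T hT m k p.1) t)) p) := by
  have := ((hY.stopped FbarRaw_mono hr).stopped FbarRaw_mono (sigb_stop hT m (k+1))).sub
    ((hY.stopped FbarRaw_mono hr).stopped FbarRaw_mono (sigb_stop hT m k))
  exact this

lemma one_measAt {a : PathPair T → ℝ} (ha : Stop (FbarRaw T) T a) (c : ℝ) :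
    MeasAt (FbarRaw T) T a (fun _ => c) := fun u hu =>
  Measurable.ite (ha u hu) measurable_const measurable_const

lemma ZZ_eq (hrn : ∀ p, r p ≤ rho hT n p) (k : ℕ) {t : ℝ} (ht : t ≤ T) (p : PathPair T) :
    XX hT m r k t p * XX hT m r k t p - AA hT m r k t p =
    2 * (SSbarProc T hT (min (r p) (min (sig T hT m (k+1) p.1) t)) p -
      SSbarProc T hT (min (r p) (min (sig T hT m k p.1) t)) p) -
    2 * cl n (SbarProc T hT (min (sig T hT m k p.1) (r p)) p) * XX hT m r k t p := by
  unfold XX AA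
  rcases dich hT m (hrn p) k ht with h | h
  · rw [h]; ring
  · rw [h.2.2, h.1, I_eq, I_eq]; ring

lemma XX_mart (hS : LocMart Q (FbarRaw T) T (SbarProc T hT))
    (hr : Stop (FbarRaw T) T r) (hr0 : ∀ p, 0 ≤ r p) (hrn : ∀ p, r p ≤ rho hT n p) (k : ℕ) :
    Mart Q (FbarRaw T) T (XX hT m r k) := by
  refine (SI_Mart (P := Q) FbarRaw_le FbarRaw_mono (Sr_CA hT hr)
    (Sr_mart hT hS hr hr0 hrn) (sigb_stop hT m k) (sigb_stop hT m (k+1))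
    (fun p => sig_succ_le hT m k p.1) (one_measAt (sigb_stop hT m k) 1) (C := 1)
    (ae_of_all _ fun p => by simp)).congr fun t ht => ae_of_all _ fun p => ?_
  simp [XX]

lemma ZZ_mart (hS : LocMart Q (FbarRaw T) T (SbarProc T hT))
    (hI : LocMart Q (FbarRaw T) T (SSbarProc T hT))
    (hr : Stop (FbarRaw T) T r) (hr0 : ∀ p, 0 ≤ r p) (hrn : ∀ p, r p ≤ rho hT n p) (k : ℕ) :
    Mart Q (FbarRaw T) T (fun t p => XX hT m r k t p * XX hT m r k t p - AA hT m r k t p) := by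
  refine ((SI_Mart (P := Q) FbarRaw_le FbarRaw_mono (Ir_CA hT hr)
    (Ir_mart hT hI hr hr0 hrn) (sigb_stop hT m k) (sigb_stop hT m (k+1))
    (fun p => sig_succ_le hT m k p.1) (one_measAt (sigb_stop hT m k) 2) (C := 2)
    (ae_of_all _ fun p => by simp)).sub ((SI_Mart (P := Q) FbarRaw_le FbarRaw_mono (Sr_CA hT hr)
    (Sr_mart hT hS hr hr0 hrn) (sigb_stop hT m k) (sigb_stop hT m (k+1))
    (fun p => sig_succ_le hT m k p.1) (cl_measAt hT m n k hr) (C := n)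
    (ae_of_all _ fun p => cl_bd n _)).const_mul 2)).congr fun t ht => ae_of_all _ fun p => ?_
  simp only
  rw [ZZ_eq hT m hrn k ht.2 p, XX]
  ring

lemma XX_bd (hrn : ∀ p, r p ≤ rho hT n p) (k : ℕ) {t : ℝ} (ht : t ≤ T) (p : PathPair T) :
    |XX hT m r k t p| ≤ (2:ℝ) ^ (-(m:ℤ)) := by
  unfold XX
  rcases dich hT m (hrn p) k ht with h | h
  · rw [h, sub_self, abs_zero]; positivity
  · rw [h.1]
    refine sig_osc hT m k p.1 ?_ ((min_le_right _ _).trans (min_le_left _ _))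
      ((min_le_right _ _).trans ((min_le_right _ _).trans ht))
    exact le_min (h.2.1.le.trans (min_le_left _ _))
      (le_min (sig_succ_le hT m k p.1) (h.2.1.le.trans (min_le_right _ _)))

lemma AA_mono (hr0 : ∀ p, 0 ≤ r p) (k : ℕ) {p : PathPair T}
    (hV : MonotoneOn (fun t => VbarProc T hT t p) (Icc 0 T)) :
    MonotoneOn (fun t => AA hT m r k t p) (Icc 0 T) := by
  intro s hs t ht hst
  have key : ∀ {x y : ℝ}, 0 ≤ x → x ≤ y → y ≤ T → VbarProc T hT x p ≤ VbarProc T hT y p :=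
    fun h1 h2 h3 => hV ⟨h1, h2.trans h3⟩ ⟨h1.trans h2, h3⟩ h2
  have n0 := sig_nonneg hT m k p.1
  have n1 := sig_nonneg hT m (k+1) p.1
  have n2 := sig_succ_le hT m k p.1
  simp only [AA]
  rcases le_total s (sig T hT m k p.1) with h | h
  · rw [min_eq_right h, min_eq_right (h.trans n2), sub_self]
    refine sub_nonneg.2 (key (le_min (hr0 p) (le_min n0 ht.1)) ?_ ?_)
    · exact min_le_min_left _ (min_le_min_right _ n2)
    · exact (min_le_right _ _).trans ((min_le_right _ _).trans ht.2)
  · rw [min_eq_left h, min_eq_left (h.trans hst)]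
    refine sub_le_sub_right (key (le_min (hr0 p) (le_min n1 hs.1)) ?_ ?_) _
    · exact min_le_min_left _ (min_le_min_left _ hst)
    · exact (min_le_right _ _).trans ((min_le_right _ _).trans ht.2)

def UU (r : PathPair T → ℝ) (K : ℕ) (p : PathPair T) : ℝ :=
  2 * DD hT m (min (sig T hT m K p.1) (min (r p) T)) p

lemma UU_zero (hr0 : ∀ p, 0 ≤ r p) (p : PathPair T) : UU hT m r 0 p = 0 := by
  unfold UU
  rw [show sig T hT m 0 p.1 = 0 from rfl, min_eq_left (le_min (hr0 p) hT), DD_zero, mul_zero]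

lemma UU_succ (hrn : ∀ p, r p ≤ rho hT n p) (K : ℕ) (p : PathPair T) :
    UU hT m r (K+1) p = UU hT m r K p - (XX hT m r K T p * XX hT m r K T p - AA hT m r K T p) := by
  rw [ZZ_eq hT m hrn K le_rfl]
  unfold UU DD
  rw [← PS_eq, ← PS_eq]
  have e : PS hT m (K+1) (min (r p) T) p.1 = PS hT m K (min (r p) T) p.1 +
      SbarProc T hT (sig T hT m K p.1) p * XX hT m r K T p := by
    unfold PS XX
    rw [Finset.sum_range_succ]
    rw [min_left_comm (r p), min_left_comm (r p)]
    rfl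
  rw [e, min_left_comm _ (r p), min_left_comm _ (r p)]
  have : SbarProc T hT (sig T hT m K p.1) p * XX hT m r K T p =
      cl n (SbarProc T hT (min (sig T hT m K p.1) (r p)) p) * XX hT m r K T p := by
    rcases dich hT m (hrn p) K le_rfl with h | h
    · simp [XX, h]
    · rw [h.2.2]
  rw [this]; ring

lemma UU_measAt (hr : Stop (FbarRaw T) T r) (K : ℕ) :
    MeasAt (FbarRaw T) T (fun p => sig T hT m K p.1) (UU hT m r K) := by
  have hs := (sigb_stop hT m K).min (hr.min (Stop.const T))
  exact MeasAt.mono (sigb_stop hT m K) (fun p => min_le_left _ _)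
    (MeasAt.comp hs (MeasAt.of_stopped FbarRaw_mono (DD_CA hT m) hs)
      (measurable_const_mul 2))

lemma UU_meas (hr : Stop (FbarRaw T) T r) (K : ℕ) : Measurable (UU hT m r K) := by
  have hs := (sigb_stop hT m K).min hr
  have := stopped_meas FbarRaw_mono (DD_CA hT m) (t := T) ⟨hT, le_rfl⟩ hs
  refine Measurable.const_mul ?_ 2
  convert this.mono (FbarRaw_le T) le_rfl using 2 with p
  rw [min_assoc]

lemma UU_step (hS : LocMart Q (FbarRaw T) T (SbarProc T hT))
    (hI : LocMart Q (FbarRaw T) T (SSbarProc T hT))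
    (hV : ∀ᵐ p ∂Q, MonotoneOn (fun t => VbarProc T hT t p) (Icc 0 T))
    (hr : Stop (FbarRaw T) T r) (hr0 : ∀ p, 0 ≤ r p) (hrn : ∀ p, r p ≤ rho hT n p) {δ : ℝ}
    (hU : ∀ K p, |UU hT m r K p| ≤ 2 * δ) (K : ℕ) :
    ∫ p, (UU hT m r (K+1) p) ^ 2 ∂Q ≤ ∫ p, (UU hT m r K p) ^ 2 ∂Q
      + 8 * ((2:ℝ) ^ (-(m:ℤ))) ^ 2 * ∫ p, AA hT m r K T p ∂Q := by
  have hTT : T ∈ Icc (0:ℝ) T := ⟨hT, le_rfl⟩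
  have hUi : ∀ K, MemLp (UU hT m r K) 2 Q := fun K =>
    MemLp.of_bound (UU_meas hT m hr K).aestronglyMeasurable (2 * δ) (ae_of_all _ (hU K))
  have hZ : (fun p => XX hT m r K T p * XX hT m r K T p - AA hT m r K T p) =
      fun p => UU hT m r K p - UU hT m r (K+1) p := by
    ext p; rw [UU_succ hT m hrn K p]; ring
  have hE := lemE (P := Q) hT FbarRaw_le (incr_CA hT m (S_CA hT) hr K) (incr_CA hT m (V_CA hT) hr K)
    (XX_mart hT m hS hr hr0 hrn K) (ZZ_mart hT m hS hI hr hr0 hrn K)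
    (ε := (2:ℝ) ^ (-(m:ℤ))) (C := 2 * n + 2 * n)
    (ae_of_all _ fun p t ht => XX_bd hT m hrn K ht.2 p)
    (hV.mono fun p hp => AA_mono hT m hr0 K hp)
    (ae_of_all _ fun p => by
      rw [min_eq_right (sig_nonneg hT m _ _), min_eq_right (sig_nonneg hT m _ _)]; simp)
    (ae_of_all _ fun p => by
      have h1 := (inc_bd hT (hr0 p) (hrn p) (min (sig T hT m (K+1) p.1) T)
        ⟨le_min (sig_nonneg hT m _ _) hT, min_le_right _ _⟩).2.2
      have h2 := (inc_bd hT (hr0 p) (hrn p) (min (sig T hT m K p.1) T)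
        ⟨le_min (sig_nonneg hT m _ _) hT, min_le_right _ _⟩).2.2
      rw [abs_le] at h1 h2
      linarith [h1.2, h2.1])
  have hO : ∫ p, UU hT m r K p * (XX hT m r K T p * XX hT m r K T p - AA hT m r K T p) ∂Q = 0 := by
    have o1 := OS (P := Q) FbarRaw_le FbarRaw_mono (Ir_CA hT hr)
      (Ir_mart hT hI hr hr0 hrn) hTT (sigb_stop hT m K) (sigb_stop hT m (K+1))
      (fun p => sig_succ_le hT m K p.1) (UU_measAt hT m hr K) (ae_of_all _ (hU K))
    have o2 := OS (P := Q) FbarRaw_le FbarRaw_mono (Sr_CA hT hr)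
      (Sr_mart hT hS hr hr0 hrn) hTT (sigb_stop hT m K) (sigb_stop hT m (K+1))
      (fun p => sig_succ_le hT m K p.1) ((UU_measAt hT m hr K).mul (cl_measAt hT m n K hr))
      (C := 2 * δ * n) (ae_of_all _ fun p => by
        rw [abs_mul]
        exact mul_le_mul (hU K p) (cl_bd n _) (abs_nonneg _) ((abs_nonneg _).trans (hU K p)))
    have i1 := (SI_Mart (P := Q) FbarRaw_le FbarRaw_mono (Ir_CA hT hr)
      (Ir_mart hT hI hr hr0 hrn) (sigb_stop hT m K) (sigb_stop hT m (K+1))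
      (fun p => sig_succ_le hT m K p.1) (UU_measAt hT m hr K) (ae_of_all _ (hU K))).1 T hTT
    have i2 := (SI_Mart (P := Q) FbarRaw_le FbarRaw_mono (Sr_CA hT hr)
      (Sr_mart hT hS hr hr0 hrn) (sigb_stop hT m K) (sigb_stop hT m (K+1))
      (fun p => sig_succ_le hT m K p.1) ((UU_measAt hT m hr K).mul (cl_measAt hT m n K hr))
      (C := 2 * δ * n) (ae_of_all _ fun p => by
        rw [abs_mul]
        exact mul_le_mul (hU K p) (cl_bd n _) (abs_nonneg _) ((abs_nonneg _).trans (hU K p)))).1 T hTT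
    have e := integral_sub (i1.const_mul 2) (i2.const_mul 2)
    rw [integral_const_mul, integral_const_mul, o1, o2] at e
    simp only [mul_zero, sub_zero] at e
    rw [← e]
    congr 1
    ext p
    rw [ZZ_eq hT m hrn K le_rfl p, XX]; ring
  have hZ' : ∀ p, XX hT m r K T p * XX hT m r K T p - AA hT m r K T p =
      UU hT m r K p - UU hT m r (K+1) p := fun p => congrFun hZ p
  simp only [hZ'] at hO
  have hE' : ∫ p, (UU hT m r K p - UU hT m r (K+1) p) ^ 2 ∂Q ≤
      8 * ((2:ℝ) ^ (-(m:ℤ))) ^ 2 * ∫ p, AA hT m r K T p ∂Q := by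
    refine le_trans (le_of_eq ?_) hE
    congr 1
    ext p
    exact congrArg (· ^ 2) (congrFun hZ p).symm
  have e2 : ∫ p, (UU hT m r (K+1) p) ^ 2 ∂Q = ∫ p, (UU hT m r K p) ^ 2 ∂Q +
      ∫ p, (UU hT m r K p - UU hT m r (K+1) p) ^ 2 ∂Q
      - 2 * ∫ p, UU hT m r K p * (UU hT m r K p - UU hT m r (K+1) p) ∂Q := by
    have j1 := (hUi K).integrable_sq
    have j2 : Integrable (fun p => (UU hT m r K p - UU hT m r (K+1) p) ^ 2) Q :=
      ((hUi K).sub (hUi (K+1))).integrable_sq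
    have j3 := (hUi K).integrable_mul ((hUi K).sub (hUi (K+1)))
    rw [← integral_const_mul, ← integral_add j1 j2, ← integral_sub]
    · congr 1; ext p; ring
    · exact j1.add j2
    · exact j3.const_mul 2
  rw [e2, hO]; linarith

lemma UU_bound (hS : LocMart Q (FbarRaw T) T (SbarProc T hT))
    (hI : LocMart Q (FbarRaw T) T (SSbarProc T hT))
    (hV : ∀ᵐ p ∂Q, MonotoneOn (fun t => VbarProc T hT t p) (Icc 0 T))
    (hr : Stop (FbarRaw T) T r) (hr0 : ∀ p, 0 ≤ r p) (hrn : ∀ p, r p ≤ rho hT n p) {δ : ℝ}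
    (hU : ∀ K p, |UU hT m r K p| ≤ 2 * δ) (K : ℕ) :
    ∫ p, (UU hT m r K p) ^ 2 ∂Q ≤ 8 * ((2:ℝ) ^ (-(m:ℤ))) ^ 2 * (2 * n) := by
  have hTT : T ∈ Icc (0:ℝ) T := ⟨hT, le_rfl⟩
  set f : ℕ → PathPair T → ℝ := fun K p =>
    VbarProc T hT (min (r p) (min (sig T hT m K p.1) T)) p - VbarProc T hT 0 p with hf
  have fb : ∀ K p, |f K p| ≤ 2 * n := fun K p =>
    (inc_bd hT (hr0 p) (hrn p) (min (sig T hT m K p.1) T)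
        ⟨le_min (sig_nonneg hT m _ _) hT, min_le_right _ _⟩).2.2
  have fm : ∀ K, Measurable (f K) := by
    intro K
    have := (((V_CA hT).stopped FbarRaw_mono hr).stopped FbarRaw_mono (sigb_stop hT m K)).sub
      ((V_CA hT).init FbarRaw_mono)
    exact (this.adapted T hTT).mono (FbarRaw_le T) le_rfl
  have fi : ∀ K, Integrable (f K) Q := fun K =>
    Integrable.of_bound (fm K).aestronglyMeasurable (2 * n) (ae_of_all _ (fb K))
  have main : ∫ p, (UU hT m r K p) ^ 2 ∂Q ≤ 8 * ((2:ℝ) ^ (-(m:ℤ))) ^ 2 * ∫ p, f K p ∂Q := by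
    induction K with
    | zero =>
      simp only [UU_zero hT m hr0, hf]
      rw [show (fun p : PathPair T => VbarProc T hT (min (r p) (min (sig T hT m 0 p.1) T)) p - VbarProc T hT 0 p)
        = fun _ => 0 from ?_]
      · simp
      · ext p
        rw [show sig T hT m 0 p.1 = 0 from rfl, min_eq_left hT, min_eq_right (hr0 p), sub_self]
    | succ K ih =>
      have h1 := UU_step hT m hS hI hV hr hr0 hrn hU K
      have e : ∫ p, AA hT m r K T p ∂Q = ∫ p, f (K+1) p ∂Q - ∫ p, f K p ∂Q := by
        rw [← integral_sub (fi _) (fi _)]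
        congr 1; ext p; simp only [AA, hf]; ring
      rw [e] at h1
      linarith
  refine main.trans (mul_le_mul_of_nonneg_left ?_ (by positivity))
  have := integral_mono (fi K) (integrable_const (2 * (n:ℝ))) fun p => (abs_le.1 (fb K p)).2
  simpa using this

lemma D_bound (hS : LocMart Q (FbarRaw T) T (SbarProc T hT))
    (hI : LocMart Q (FbarRaw T) T (SSbarProc T hT))
    (hV : ∀ᵐ p ∂Q, MonotoneOn (fun t => VbarProc T hT t p) (Icc 0 T))
    (hr : Stop (FbarRaw T) T r) (hr0 : ∀ p, 0 ≤ r p) (hrn : ∀ p, r p ≤ rho hT n p) {δ : ℝ}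
    (hU : ∀ K p, |UU hT m r K p| ≤ 2 * δ) :
    ∫ p, (2 * DD hT m (min (r p) T) p) ^ 2 ∂Q ≤ 8 * ((2:ℝ) ^ (-(m:ℤ))) ^ 2 * (2 * n) := by
  refine le_of_tendsto' (x := atTop) (f := fun K => ∫ p, (UU hT m r K p) ^ 2 ∂Q) ?_
    (UU_bound hT m hS hI hV hr hr0 hrn hU)
  refine tendsto_integral_of_dominated_convergence (fun _ => (2 * δ) ^ 2)
    (fun K => ((UU_meas hT m hr K).pow_const 2).aestronglyMeasurable) (integrable_const _)
    (fun K => ae_of_all _ fun p => ?_) (ae_of_all _ fun p => ?_)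
  · rw [Real.norm_eq_abs, abs_pow]
    exact pow_le_pow_left₀ (abs_nonneg _) (hU K p) 2
  · obtain ⟨K0, hK0⟩ := sig_eventually hT m p.1
    refine tendsto_const_nhds.congr' ?_
    filter_upwards [eventually_ge_atTop K0] with K hK
    unfold UU
    rw [hK0 K hK, min_eq_right (show min (r p) T ≤ T + 1 from (min_le_right _ _).trans (by linarith))]

end core2
end PathwiseSuperhedging

namespace PathwiseSuperhedging

section bc
variable {T : ℝ} (hT : 0 ≤ T) (m : ℕ)

def dl (m : ℕ) : ℝ := Real.sqrt ((1/2:ℝ) ^ m)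
lemma dl_pos (m : ℕ) : 0 < dl m := Real.sqrt_pos.2 (by positivity)
lemma dl_sq (m : ℕ) : dl m ^ 2 = (1/2:ℝ) ^ m := Real.sq_sqrt (by positivity)

def DA (t : ℝ) (p : PathPair T) : ℝ := |DD hT m t p|
lemma DA_CA : CA (FbarRaw T) T (DA hT m) := (DD_CA hT m).comp continuous_abs

def kap (δ : ℝ) : PathPair T → ℝ := hit T δ (T + 1) (DA hT m)

lemma kap_stop (δ : ℝ) : Stop (FbarRaw T) T (kap hT m δ) :=
  hit_stop FbarRaw_mono (by linarith) (DA_CA hT m)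

lemma kap_nonneg (δ : ℝ) (p : PathPair T) : 0 ≤ kap hT m δ p :=
  hit_nonneg hT (by linarith) ((DA_CA hT m).cont p)

lemma kap_le {δ : ℝ} (hδ : 0 ≤ δ) (p : PathPair T) {t : ℝ} (h0 : 0 ≤ t) (h1 : t ≤ T)
    (h2 : t ≤ kap hT m δ p) : |DD hT m t p| ≤ δ := by
  refine (hit_le (Y := DA hT m) (by linarith) ((DA_CA hT m).cont p) h0 h1 h2).trans (max_le le_rfl ?_)
  simp [DA, DD_zero, hδ]

lemma kap_gt {δ : ℝ} (p : PathPair T) (h : T < kap hT m δ p) : ∀ t ∈ Icc (0:ℝ) T, |DD hT m t p| < δ := by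
  rcases hit_cases (c := δ) (Y := DA hT m) (show T < T + 1 by linarith) ((DA_CA hT m).cont p) with h1 | h1
  · exact fun t ht => h1.2 t ht.1 ht.2
  · exact absurd h1.2.1 (not_le.2 h)

lemma kap_hit {δ : ℝ} (p : PathPair T) (h : kap hT m δ p ≤ T) : δ ≤ |DD hT m (kap hT m δ p) p| := by
  rcases hit_cases (c := δ) (Y := DA hT m) (show T < T + 1 by linarith) ((DA_CA hT m).cont p) with h1 | h1
  · have : kap hT m δ p = T + 1 := h1.1
    linarith
  · exact h1.2.2.1

variable {Q : Measure (PathPair T)} [IsProbabilityMeasure Q]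

lemma bad_meas (hS : LocMart Q (FbarRaw T) T (SbarProc T hT))
    (hI : LocMart Q (FbarRaw T) T (SSbarProc T hT))
    (hV : ∀ᵐ p ∂Q, MonotoneOn (fun t => VbarProc T hT t p) (Icc 0 T)) (n : ℕ) :
    Q {p | kap hT m (dl m) p ≤ T ∧ kap hT m (dl m) p ≤ rho hT n p} ≤
      ENNReal.ofReal (4 * n * (1/2:ℝ) ^ m) := by
  set r : PathPair T → ℝ := fun p => min (rho hT n p) (kap hT m (dl m) p) with hrdef
  have hr : Stop (FbarRaw T) T r := (rho_stop hT n).min (kap_stop hT m _)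
  have hr0 : ∀ p, 0 ≤ r p := fun p => le_min (rho_nonneg hT n p) (kap_nonneg hT m _ p)
  have hrn : ∀ p, r p ≤ rho hT n p := fun p => min_le_left _ _
  have hU : ∀ K p, |UU hT m r K p| ≤ 2 * dl m := by
    intro K p
    unfold UU
    rw [abs_mul, abs_two]
    refine mul_le_mul_of_nonneg_left (kap_le hT m (dl_pos m).le p
      (le_min (sig_nonneg hT m _ _) (le_min (hr0 p) hT))
      ((min_le_right _ _).trans (min_le_right _ _)) ?_) (by norm_num)
    exact (min_le_right _ _).trans ((min_le_left _ _).trans (min_le_right _ _))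
  have hb := D_bound hT m hS hI hV hr hr0 hrn hU
  have hm : Measurable fun p => (2 * DD hT m (min (r p) T) p) ^ 2 :=
    (((stopped_meas FbarRaw_mono (DD_CA hT m) (t := T) ⟨hT, le_rfl⟩ hr).mono (FbarRaw_le T) le_rfl).const_mul 2).pow_const 2
  have hi : Integrable (fun p => (2 * DD hT m (min (r p) T) p) ^ 2) Q := by
    refine Integrable.of_bound hm.aestronglyMeasurable ((2 * dl m) ^ 2) (ae_of_all _ fun p => ?_)
    rw [Real.norm_eq_abs, abs_pow]
    refine pow_le_pow_left₀ (abs_nonneg _) ?_ 2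
    rw [abs_mul, abs_two]
    exact mul_le_mul_of_nonneg_left (kap_le hT m (dl_pos m).le p
      (le_min (hr0 p) hT) (min_le_right _ _) ((min_le_left _ _).trans (min_le_right _ _))) (by norm_num)
  have hmk := mul_meas_ge_le_integral_of_nonneg (μ := Q) (ae_of_all _ fun p => sq_nonneg _) hi (4 * (1/2:ℝ) ^ m)
  have hsub : {p | kap hT m (dl m) p ≤ T ∧ kap hT m (dl m) p ≤ rho hT n p} ⊆
      {p | 4 * (1/2:ℝ) ^ m ≤ (2 * DD hT m (min (r p) T) p) ^ 2} := by
    rintro p ⟨h1, h2⟩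
    show 4 * (1/2:ℝ) ^ m ≤ (2 * DD hT m (min (r p) T) p) ^ 2
    have : min (r p) T = kap hT m (dl m) p := by
      simp only [hrdef]
      rw [min_eq_right h2, min_eq_left h1]
    rw [this, mul_pow, ← dl_sq, ← sq_abs (DD hT m _ p)]
    have := pow_le_pow_left₀ (dl_pos m).le (kap_hit hT m p h1) 2
    linarith
  refine (measure_mono hsub).trans ?_
  rw [← ofReal_measureReal]
  refine ENNReal.ofReal_le_ofReal ?_
  have h3 := hmk.trans hb
  have e : ((2:ℝ) ^ (-(m:ℤ))) = (1/2:ℝ) ^ m := by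
    rw [zpow_neg, zpow_natCast, one_div, inv_pow]
  rw [e] at h3
  have hp : (0:ℝ) < (1/2:ℝ) ^ m := by positivity
  have h4 : 4 * (1/2:ℝ) ^ m * Q.real {p | 4 * (1/2:ℝ) ^ m ≤ (2 * DD hT m (min (r p) T) p) ^ 2}
      ≤ 4 * (1/2:ℝ) ^ m * (4 * n * (1/2:ℝ) ^ m) := h3.trans (le_of_eq (by ring))
  exact le_of_mul_le_mul_left h4 (by positivity)

lemma unif_ae (hS : LocMart Q (FbarRaw T) T (SbarProc T hT))
    (hI : LocMart Q (FbarRaw T) T (SSbarProc T hT))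
    (hV : ∀ᵐ p ∂Q, MonotoneOn (fun t => VbarProc T hT t p) (Icc 0 T)) :
    ∀ᵐ p ∂Q, ∀ᶠ m in atTop, ∀ t ∈ Icc (0:ℝ) T, |DD hT m t p| < dl m := by
  have h1 : ∀ n : ℕ, ∀ᵐ p ∂Q, ∀ᶠ m in atTop,
      p ∉ {p | kap hT m (dl m) p ≤ T ∧ kap hT m (dl m) p ≤ rho hT n p} := by
    intro n
    refine ae_eventually_notMem (ne_top_of_le_ne_top ?_
      (ENNReal.tsum_le_tsum fun m => bad_meas hT m hS hI hV n))
    exact Summable.tsum_ofReal_ne_top ((summable_geometric_of_lt_one (by norm_num) (by norm_num)).mul_left _)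
  filter_upwards [ae_all_iff.2 h1] with p hp
  obtain ⟨n, hn⟩ := hit_n_eventually (T := T) (Y := fun t p => |SbarProc T hT t p| + |VbarProc T hT t p|) ((rho_Y_CA hT).cont p)
  have hn := hn n le_rfl
  filter_upwards [hp n] with m hm
  refine kap_gt hT m p ?_
  by_contra hc
  push Not at hc
  refine hm ⟨hc, ?_⟩
  have : rho hT n p = T + 1 + n := hn
  rw [this]
  linarith [rho_lt (T := T) n]

lemma dl_tendsto : Tendsto dl atTop (𝓝 0) := by
  have : Tendsto (fun m : ℕ => (1/2:ℝ) ^ m) atTop (𝓝 0) :=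
    tendsto_pow_atTop_nhds_zero_of_lt_one (by norm_num) (by norm_num)
  have h2 := this.sqrt
  rw [Real.sqrt_zero] at h2
  exact h2

lemma qv_of_unif {p : PathPair T} (h : ∀ᶠ m in atTop, ∀ t ∈ Icc (0:ℝ) T, |DD hT m t p| < dl m)
    (hV : MonotoneOn (fun t => VbarProc T hT t p) (Icc 0 T)) (h0 : VbarProc T hT 0 p = 0) :
    p.1 ∈ BigOmega T hT ∧ qv T hT p.1 = p.2 := by
  have hI0 : SSbarProc T hT 0 p = 0 := by
    rw [I_eq, h0]; ring
  have hlim : ∀ t ∈ Icc (0:ℝ) T, SS T hT t p.1 = SSbarProc T hT t p := by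
    intro t ht
    refine Tendsto.liminf_eq ?_
    rw [tendsto_iff_dist_tendsto_zero]
    refine squeeze_zero' (Eventually.of_forall fun _ => dist_nonneg) ?_ dl_tendsto
    filter_upwards [h] with m hm
    have := hm t ht
    rw [DD, hI0, sub_zero] at this
    exact this.le
  have hq : ∀ t ∈ Icc (0:ℝ) T, qvRaw T hT p.1 t = VbarProc T hT t p := by
    intro t ht
    rw [qvRaw, hlim t ht]
    simp only [SSbarProc, VbarProc]; ring
  have hO : p.1 ∈ BigOmega T hT := by
    constructor
    · rw [Metric.tendstoUniformly_iff]
      intro ε hε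
      filter_upwards [h, dl_tendsto.eventually (gt_mem_nhds hε)] with m hm hm2 t
      have := hm t t.2
      rw [DD, hI0, sub_zero] at this
      rw [dist_comm, hlim t t.2]
      exact this.trans hm2
    · intro s hs t ht hst
      rw [hq s hs, hq t ht]
      exact hV hs ht hst
  refine ⟨hO, ?_⟩
  have hq' : (fun t : Icc (0:ℝ) T => qvRaw T hT p.1 t) = p.2 := by
    ext t
    rw [hq t t.2, VbarProc, ev, clamp_of_mem hT t.2]
  have hc : Continuous fun t : Icc (0:ℝ) T => qvRaw T hT p.1 t := by
    rw [hq']; exact p.2.continuous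
  rw [qv, dif_pos ⟨hO, hc⟩]
  ext t
  exact congrFun hq' t

/-- mass one on a possibly nonmeasurable set -/
lemma ae_of_mass {E : Type*} [MeasurableSpace E] {P : Measure E} [IsProbabilityMeasure P] {A B : Set E}
    (hA : P A = 1) (hB : MeasurableSet B) (hAB : A ⊆ B) : ∀ᵐ x ∂P, x ∈ B := by
  have : P B = 1 := le_antisymm prob_le_one (hA ▸ measure_mono hAB)
  exact (mem_ae_iff_prob_eq_one hB).2 this

def VG (hT : 0 ≤ T) : Set (PathPair T) := {p | p.2 (t0 T hT) = 0 ∧ Monotone p.2}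

lemma VG_meas : MeasurableSet (VG hT) := by
  have hc : ∀ s, Continuous fun p : PathPair T => p.2 s := fun s =>
    (continuous_eval_const (F := Path T) s).comp continuous_snd
  have e : VG hT = {p | p.2 (t0 T hT) = 0} ∩ ⋂ s : Icc (0:ℝ) T, ⋂ t : Icc (0:ℝ) T, ⋂ _ : s ≤ t, {p | p.2 s ≤ p.2 t} := by
    ext p
    simp only [VG, Monotone, mem_inter_iff, mem_ofPred_eq, mem_iInter]
  have : IsClosed (VG hT) := by
    rw [e]
    exact (isClosed_eq (hc _) continuous_const).inter
      (isClosed_iInter fun s => isClosed_iInter fun t => isClosed_iInter fun _ => isClosed_le (hc _) (hc _))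
  exact this.measurableSet

lemma VG_good {p : PathPair T} (hp : p ∈ VG hT) : VbarProc T hT 0 p = 0 ∧
    MonotoneOn (fun t => VbarProc T hT t p) (Icc 0 T) := by
  have h0 : clamp T hT 0 = t0 T hT := clamp_of_mem hT ⟨le_rfl, hT⟩
  refine ⟨?_, fun s hs t ht hst => ?_⟩
  · rw [VbarProc, ev, h0]; exact hp.1
  · exact hp.2 (monotone_projIcc hT hst)

lemma fst_S_meas (t : ℝ) : Measurable (fun ω : Path T => ev T hT ω t) :=
  (continuous_eval_const (F := Path T) _).measurable

theorem dir2 {Xibar : Set (PathPair T)} (A2 : ∀ p ∈ Xibar, p.2 (t0 T hT) = 0 ∧ Monotone p.2)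
    (hQ : Q ∈ MbarSet T hT Xibar) :
    Q.map Prod.fst ∈ MSet T hT {ω ∈ BigOmega T hT | (ω, qv T hT ω) ∈ Xibar} := by
  obtain ⟨-, hS, hI, hX⟩ := hQ
  have hS' : LocMart Q (FbarRaw T) T (SbarProc T hT) := hS
  have hI' : LocMart Q (FbarRaw T) T (SSbarProc T hT) := hI
  have hVG : ∀ᵐ p ∂Q, p ∈ VG hT := ae_of_mass hX (VG_meas hT) A2
  have hu := unif_ae hT hS' hI' (hVG.mono fun p hp => (VG_good hT hp).2)
  have hall : ∀ᵐ p ∂Q, p.1 ∈ BigOmega T hT ∧ qv T hT p.1 = p.2 := by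
    filter_upwards [hVG, hu] with p h1 h2
    exact qv_of_unif hT h2 (VG_good hT h1).2 (VG_good hT h1).1
  have hP : IsProbabilityMeasure (Q.map Prod.fst) := Measure.isProbabilityMeasure_map measurable_fst.aemeasurable
  refine ⟨hP, ?_, ?_⟩
  · have hYC : CA (Fraw T) T (fun t ω => |ev T hT ω t|) := (ev_CA hT).comp continuous_abs
    refine ⟨fun n => hit T n (T + 1 + n) (fun t ω => |ev T hT ω t|),
      fun n => hit_stop Fraw_mono (rho_lt n) hYC, ae_of_all _ fun ω => hit_n_good (hYC.cont ω), fun n => ?_⟩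
    have hst : Stop (Fraw T) T (hit T n (T + 1 + n) (fun t ω => |ev T hT ω t|)) :=
      hit_stop Fraw_mono (rho_lt n) hYC
    set τ : Path T → ℝ := hit T n (T + 1 + n) (fun t ω => |ev T hT ω t|) with hτ
    have hτ0 : ∀ ω, 0 ≤ τ ω := fun ω => hit_nonneg hT (rho_lt n) (hYC.cont ω)
    have hS0 : Integrable (SbarProc T hT 0) Q := by
      obtain ⟨τ', h1, h2, h3⟩ := hS'
      refine ((h3 0).1 0 ⟨le_rfl, hT⟩).congr (ae_of_all _ fun p => ?_)
      exact (S_CA hT).neg _ (min_le_right _ _) p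
    have hbd : ∀ p : PathPair T, ∀ t ∈ Icc (0:ℝ) T,
        |SbarProc T hT (min (τ p.1) t) p - SbarProc T hT 0 p| ≤ 2 * n := by
      intro p t ht
      have hn : (0:ℝ) ≤ n := Nat.cast_nonneg n
      have hle : ∀ t, 0 ≤ t → t ≤ T → t ≤ τ p.1 → |ev T hT p.1 t| ≤ max (n:ℝ) |ev T hT p.1 0| :=
        fun t h0 h1 h2 => hit_le (Y := fun t ω => |ev T hT ω t|) (rho_lt n) (hYC.cont p.1) h0 h1 h2
      rcases lt_or_ge |ev T hT p.1 0| n with h | h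
      · have h1 := hle (min (τ p.1) t) (le_min (hτ0 _) ht.1) ((min_le_right _ _).trans ht.2) (min_le_left _ _)
        rw [max_eq_left h.le] at h1
        have := abs_sub (SbarProc T hT (min (τ p.1) t) p) (SbarProc T hT 0 p)
        have e1 : |SbarProc T hT (min (τ p.1) t) p| ≤ n := h1
        have e2 : |SbarProc T hT 0 p| < n := h
        linarith
      · have : τ p.1 = 0 := by
          rcases hit_cases (c := n) (Y := fun t ω => |ev T hT ω t|) (rho_lt n) (hYC.cont p.1) with h1 | h1
          · exact absurd (h1.2 0 le_rfl hT) (not_lt.2 h)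
          · refine le_antisymm ?_ (hτ0 _)
            by_contra h2
            push Not at h2
            exact absurd (h1.2.2.2 0 le_rfl h2) (not_lt.2 h)
        rw [this, min_eq_left ht.1, sub_self, abs_zero]; positivity
    have hM := locmart_mart (P := Q) FbarRaw_le FbarRaw_mono (S_CA hT) hS' (r := fun p => τ p.1) hst.lift
      (C := 2 * n) (ae_of_all _ hbd)
    have hcon : Mart Q (FbarRaw T) T (fun _ p => SbarProc T hT 0 p) :=
      ⟨fun _ _ => hS0, fun _ _ _ _ _ _ _ => rfl⟩
    have hM2 : Mart Q (FbarRaw T) T (fun t p => SbarProc T hT (min (τ p.1) t) p) :=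
      (hM.add hcon).congr fun t ht => ae_of_all _ fun p => by simp
    have hmeas : ∀ t ∈ Icc (0:ℝ) T, Measurable (fun ω : Path T => Sproc T hT (min (τ ω) t) ω) := fun t ht =>
      (stopped_meas Fraw_mono (ev_CA hT) ht hst).mono (Fraw_le t) le_rfl
    refine ⟨fun t ht => ?_, fun s t hs ht hst' A hA => ?_⟩
    · rw [integrable_map_measure (hmeas t ht).aestronglyMeasurable measurable_fst.aemeasurable]
      exact hM2.1 t ht
    · have hA' := Fraw_le s A hA
      rw [setIntegral_map hA' (hmeas t ht).aestronglyMeasurable measurable_fst.aemeasurable,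
        setIntegral_map hA' (hmeas s hs).aestronglyMeasurable measurable_fst.aemeasurable]
      exact hM2.2 s t hs ht hst' _ (fst_meas s hA)
  · refine le_antisymm prob_le_one ?_
    refine le_trans ?_ (Measure.le_map_apply measurable_fst.aemeasurable _)
    rw [← hX]
    refine measure_mono_ae ?_
    filter_upwards [hall] with p hp hpX
    refine ⟨hp.1, ?_⟩
    rw [hp.2]; exact hpX

end bc
end PathwiseSuperhedging

namespace PathwiseSuperhedging

section dirone
variable {T : ℝ} (hT : 0 ≤ T)

lemma path_meas {E : Type*} [MeasurableSpace E] (hT : 0 ≤ T) {f : E → Path T}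
    (hf : ∀ s, Measurable fun x => f x s) : Measurable f := by
  haveI : Nonempty (Icc (0:ℝ) T) := ⟨t0 T hT⟩
  set d := TopologicalSpace.denseSeq (Icc (0:ℝ) T)
  have hd : DenseRange d := TopologicalSpace.denseRange_denseSeq _
  let g : Path T → (ℕ → ℝ) := fun ω i => ω (d i)
  have hg : Continuous g := continuous_pi fun i => continuous_eval_const (F := Path T) _
  have hi : Function.Injective g := by
    intro a b hab
    have : (a : Icc (0:ℝ) T → ℝ) = b := hd.equalizer a.continuous b.continuous hab
    exact DFunLike.coe_injective this
  have he := hg.measurableEmbedding hi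
  rw [← he.measurable_comp_iff]
  exact measurable_pi_lambda _ fun i => hf _

lemma SS_adapted {t : ℝ} (ht : t ∈ Icc (0:ℝ) T) : Measurable[Fraw T t] (SS T hT t) := by
  unfold SS
  exact Measurable.liminf (mδ := Fraw T t) fun m => (Sm_CA hT m).adapted t ht

lemma qvRaw_adapted {t : ℝ} (ht : t ∈ Icc (0:ℝ) T) : Measurable[Fraw T t] (fun ω => qvRaw T hT ω t) := by
  have h1 := (ev_CA hT).adapted t ht
  have h2 := ((ev_CA hT).adapted 0 ⟨le_rfl, hT⟩).mono (Fraw_mono ht.1) le_rfl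
  exact ((h1.pow_const 2).sub (h2.pow_const 2)).sub ((SS_adapted hT ht).const_mul 2)

lemma qvRaw_cont {ω : Path T} (h : TendstoUniformly (fun m (t : Icc (0:ℝ) T) => Sm T hT m (t : ℝ) ω)
        (fun t => SS T hT (t : ℝ) ω) atTop) : Continuous fun t : Icc (0:ℝ) T => qvRaw T hT ω t := by
  have hs : Continuous fun t : Icc (0:ℝ) T => SS T hT (t : ℝ) ω :=
    h.continuous (Eventually.of_forall fun m => ((Sm_CA hT m).cont ω).comp continuous_subtype_val).frequently
  have he : Continuous fun t : Icc (0:ℝ) T => ev T hT ω t := (ev_cont hT ω).comp continuous_subtype_val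
  exact ((he.pow 2).sub continuous_const).sub (hs.const_mul 2)

lemma BigOmega_meas : MeasurableSet (BigOmega T hT) := by
  haveI : Nonempty (Icc (0:ℝ) T) := ⟨t0 T hT⟩
  set d := TopologicalSpace.denseSeq (Icc (0:ℝ) T)
  have hd : DenseRange d := TopologicalSpace.denseRange_denseSeq _
  have e : BigOmega T hT = (⋂ k : ℕ, ⋃ N : ℕ, ⋂ a : ℕ, ⋂ b : ℕ, ⋂ _ : N ≤ a, ⋂ _ : N ≤ b, ⋂ i : ℕ,
      {ω | |Sm T hT a (d i) ω - Sm T hT b (d i) ω| ≤ 1 / ((k:ℝ) + 1)}) ∩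
      ⋂ i : ℕ, ⋂ j : ℕ, ⋂ _ : d i ≤ d j, {ω | qvRaw T hT ω (d i) ≤ qvRaw T hT ω (d j)} := by
    ext ω
    simp only [mem_inter_iff, mem_iInter, mem_iUnion, mem_ofPred_eq]
    constructor
    · rintro ⟨h1, h2⟩
      refine ⟨fun k => ?_, fun i j hij => h2 (d i).2 (d j).2 hij⟩
      rw [Metric.tendstoUniformly_iff] at h1
      have hk : (0:ℝ) < 1 / ((k:ℝ) + 1) := by positivity
      obtain ⟨N, hN⟩ := eventually_atTop.1 (h1 _ (half_pos hk))
      refine ⟨N, fun a b ha hb i => ?_⟩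
      have e1 := hN a ha (d i)
      have e2 := hN b hb (d i)
      rw [← Real.dist_eq]
      have := dist_triangle_left (Sm T hT a (d i) ω) (Sm T hT b (d i) ω) (SS T hT (d i) ω)
      linarith
    · rintro ⟨h1, h2⟩
      have hall : ∀ k : ℕ, ∃ N : ℕ, ∀ a b : ℕ, N ≤ a → N ≤ b → ∀ t : Icc (0:ℝ) T,
          |Sm T hT a t ω - Sm T hT b t ω| ≤ 1 / ((k:ℝ) + 1) := by
        intro k
        obtain ⟨N, hN⟩ := h1 k
        refine ⟨N, fun a b ha hb t => ?_⟩
        have hc : IsClosed {t : Icc (0:ℝ) T | |Sm T hT a t ω - Sm T hT b t ω| ≤ 1 / ((k:ℝ) + 1)} :=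
          isClosed_le ((((Sm_CA hT a).cont ω).comp continuous_subtype_val).sub
            (((Sm_CA hT b).cont ω).comp continuous_subtype_val)).abs continuous_const
        exact hd.induction_on t hc fun i => hN a b ha hb i
      have hlim : ∀ t : Icc (0:ℝ) T, Tendsto (fun m => Sm T hT m t ω) atTop (𝓝 (SS T hT t ω)) := by
        intro t
        have hcs : CauchySeq fun m => Sm T hT m t ω := by
          rw [Metric.cauchySeq_iff]
          intro ε hε
          obtain ⟨k, hk⟩ := exists_nat_one_div_lt hε
          obtain ⟨N, hN⟩ := hall k
          exact ⟨N, fun a ha b hb => (hN a b ha hb t).trans_lt hk⟩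
        obtain ⟨l, hl⟩ := cauchySeq_tendsto_of_complete hcs
        have : SS T hT t ω = l := hl.liminf_eq
        rw [this]; exact hl
      have hu : TendstoUniformly (fun m (t : Icc (0:ℝ) T) => Sm T hT m (t : ℝ) ω)
        (fun t => SS T hT (t : ℝ) ω) atTop := by
        rw [Metric.tendstoUniformly_iff]
        intro ε hε
        obtain ⟨k, hk⟩ := exists_nat_one_div_lt hε
        obtain ⟨N, hN⟩ := hall k
        filter_upwards [eventually_ge_atTop N] with a ha t
        refine lt_of_le_of_lt ?_ hk
        rw [dist_comm]
        refine le_of_tendsto ((tendsto_const_nhds (x := Sm T hT a t ω)).dist (hlim t)) ?_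
        filter_upwards [eventually_ge_atTop N] with b hb
        exact hN a b ha hb t
      refine ⟨hu, ?_⟩
      have hqc := qvRaw_cont hT hu
      have key : ∀ s t : Icc (0:ℝ) T, qvRaw T hT ω s ≤ qvRaw T hT ω (max s t : Icc (0:ℝ) T) := by
        intro s t
        have hc : IsClosed {x : Icc (0:ℝ) T × Icc (0:ℝ) T | qvRaw T hT ω x.1 ≤ qvRaw T hT ω (max x.1 x.2 : Icc (0:ℝ) T)} :=
          isClosed_le (hqc.comp continuous_fst) (hqc.comp (continuous_fst.max continuous_snd))
        refine (hd.prodMap hd).induction_on (p := fun x : Icc (0:ℝ) T × Icc (0:ℝ) T =>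
          qvRaw T hT ω x.1 ≤ qvRaw T hT ω (max x.1 x.2 : Icc (0:ℝ) T)) (s, t) hc ?_
        rintro ⟨i, j⟩
        show qvRaw T hT ω (d i) ≤ qvRaw T hT ω (max (d i) (d j) : Icc (0:ℝ) T)
        rcases le_total (d i) (d j) with h | h
        · rw [max_eq_right h]; exact h2 i j h
        · rw [max_eq_left h]
      intro s hs t ht hst
      have := key ⟨s, hs⟩ ⟨t, ht⟩
      rwa [max_eq_right (show (⟨s, hs⟩ : Icc (0:ℝ) T) ≤ ⟨t, ht⟩ from hst)] at this
  have mS : ∀ a (t : Icc (0:ℝ) T), Measurable (Sm T hT a t) := fun a t =>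
    ((Sm_CA hT a).adapted t t.2).mono (Fraw_le _) le_rfl
  have mq : ∀ (t : Icc (0:ℝ) T), Measurable fun ω => qvRaw T hT ω t := fun t =>
    (qvRaw_adapted hT t.2).mono (Fraw_le _) le_rfl
  rw [e]
  refine MeasurableSet.inter ?_ ?_
  · refine MeasurableSet.iInter fun k => MeasurableSet.iUnion fun N => MeasurableSet.iInter fun a =>
      MeasurableSet.iInter fun b => MeasurableSet.iInter fun _ => MeasurableSet.iInter fun _ =>
      MeasurableSet.iInter fun i => ?_
    exact measurableSet_le ((mS a _).sub (mS b _)).abs measurable_const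
  · refine MeasurableSet.iInter fun i => MeasurableSet.iInter fun j => MeasurableSet.iInter fun _ => ?_
    exact measurableSet_le (mq _) (mq _)

lemma qv_apply {ω : Path T} (h : ω ∈ BigOmega T hT) (t : Icc (0:ℝ) T) : qv T hT ω t = qvRaw T hT ω t := by
  rw [qv, dif_pos ⟨h, qvRaw_cont hT h.1⟩]; rfl

lemma qv_meas : Measurable (qv T hT) := by
  refine path_meas hT fun s => ?_
  have : (fun ω => qv T hT ω s) = (BigOmega T hT).indicator (fun ω => qvRaw T hT ω s) := by
    ext ω
    by_cases h : ω ∈ BigOmega T hT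
    · rw [indicator_of_mem h, qv_apply hT h]
    · rw [indicator_of_notMem h, qv, dif_neg (fun h' => h h'.1)]; rfl
  rw [this]
  exact ((qvRaw_adapted hT s.2).mono (Fraw_le _) le_rfl).indicator (BigOmega_meas hT)

lemma psi_meas : Measurable (psiMap T hT) := measurable_id.prodMk (qv_meas hT)

variable {Q : Measure (Path T)} [IsProbabilityMeasure Q]

lemma psi_ev (hO : ∀ᵐ ω ∂Q, ω ∈ BigOmega T hT) (s : ℝ) {A : Set (PathPair T)}
    (hA : MeasurableSet[FbarRaw T s] A) :
    ∃ B, MeasurableSet[Fraw T s] B ∧ psiMap T hT ⁻¹' A =ᵐ[Q] B := by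
  have : Measurable[eventuallyMeasurableSpace (Fraw T s) (ae Q), FbarRaw T s] (psiMap T hT) := by
    rw [measurable_iff_comap_le]
    unfold FbarRaw
    simp only [MeasurableSpace.comap_iSup, MeasurableSpace.comap_comp]
    refine iSup_le fun u => iSup_le fun hu => ?_
    rw [← measurable_iff_comap_le]
    have m1 : Measurable[Fraw T s] (fun ω : Path T => (ω u, qvRaw T hT ω u)) := by
      have h1 := (ev_CA hT).adapted u u.2
      have h1' : Measurable[Fraw T u] (fun ω : Path T => ω u) := by
        convert h1 using 2 with ω
        unfold ev; rw [clamp_of_mem hT u.2]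
      exact (Measurable.prodMk h1' (qvRaw_adapted hT u.2)).mono (Fraw_mono hu) le_rfl
    refine Measurable.eventuallyMeasurable_of_eventuallyEq (m := Fraw T s) (l := ae Q) m1 ?_
    filter_upwards [hO] with ω hω
    simp [psiMap, qv_apply hT hω u]
  exact this hA

lemma lift_mart (hO : ∀ᵐ ω ∂Q, ω ∈ BigOmega T hT) {X : ℝ → Path T → ℝ}
    (hm : ∀ t ∈ Icc (0:ℝ) T, Measurable (X t)) (hX : Mart Q (Fraw T) T X) :
    Mart (Q.map (psiMap T hT)) (FbarRaw T) T (fun t p => X t p.1) := by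
  have hp := (psi_meas hT).aemeasurable (μ := Q)
  have hm' : ∀ t ∈ Icc (0:ℝ) T, AEStronglyMeasurable (fun p : PathPair T => X t p.1) (Q.map (psiMap T hT)) :=
    fun t ht => ((hm t ht).comp measurable_fst).aestronglyMeasurable
  refine ⟨fun t ht => ?_, fun s t hs ht hst A hA => ?_⟩
  · rw [integrable_map_measure (hm' t ht) hp]
    exact hX.1 t ht
  · obtain ⟨B, hB, hAB⟩ := psi_ev hT hO s hA
    have hA' := FbarRaw_le s A hA
    rw [setIntegral_map hA' (hm' t ht) hp, setIntegral_map hA' (hm' s hs) hp,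
      setIntegral_congr_set hAB, setIntegral_congr_set hAB]
    exact hX.2 s t hs ht hst B hB

lemma fst_psi : (Q.map (psiMap T hT)).map Prod.fst = Q := by
  rw [Measure.map_map measurable_fst (psi_meas hT)]
  exact Measure.map_id

lemma good_of_psi {p : PathPair T} (hO : p.1 ∈ BigOmega T hT) (h2 : p.2 = qv T hT p.1) :
    SSbarProc T hT 0 p = 0 ∧ ∀ ε > 0, ∀ᶠ m in atTop, ∀ t ∈ Icc (0:ℝ) T, |DD hT m t p| < ε := by
  have hI : ∀ t ∈ Icc (0:ℝ) T, SSbarProc T hT t p = SS T hT t p.1 := by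
    intro t ht
    unfold SSbarProc
    have : ev T hT p.2 t = qvRaw T hT p.1 t := by
      rw [h2]; unfold ev; rw [clamp_of_mem hT ht, qv_apply hT hO]
    rw [this, qvRaw]; ring
  have h0 : SSbarProc T hT 0 p = 0 := by
    rw [hI 0 ⟨le_rfl, hT⟩]
    unfold SS
    simp [Sm_zero]
  refine ⟨h0, fun ε hε => ?_⟩
  have := hO.1
  rw [Metric.tendstoUniformly_iff] at this
  filter_upwards [this ε hε] with m hm t ht
  have := hm ⟨t, ht⟩
  rw [dist_comm, Real.dist_eq] at this
  rw [DD, h0, sub_zero, hI t ht]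
  exact this

lemma I_locmart {P : Measure (PathPair T)} [IsProbabilityMeasure P]
    (hS : LocMart P (FbarRaw T) T (SbarProc T hT))
    (hg : ∀ᵐ p ∂P, SSbarProc T hT 0 p = 0 ∧
      ∀ ε > 0, ∀ᶠ m in atTop, ∀ t ∈ Icc (0:ℝ) T, |DD hT m t p| < ε) :
    LocMart P (FbarRaw T) T (SSbarProc T hT) := by
  refine ⟨rho hT, rho_stop hT, ae_of_all _ fun p =>
    hit_n_good (Y := fun t p => |SbarProc T hT t p| + |VbarProc T hT t p|) ((rho_Y_CA hT).cont p), fun n => ?_⟩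
  let r : ℕ → PathPair T → ℝ := fun m p => min (rho hT n p) (kap hT m 1 p)
  have hr : ∀ m, Stop (FbarRaw T) T (r m) := fun m => (rho_stop hT n).min (kap_stop hT m _)
  have hr0 : ∀ m p, 0 ≤ r m p := fun m p => le_min (rho_nonneg hT n p) (kap_nonneg hT m _ p)
  have hrn : ∀ m p, r m p ≤ rho hT n p := fun m p => min_le_left _ _
  have hbd : ∀ m p, ∀ t ∈ Icc (0:ℝ) T, |Sm T hT m (min (r m p) t) p.1| ≤ 1 + ((n:ℝ) ^ 2 + n) := by
    intro m p t ht
    have h1 := kap_le hT m zero_le_one p (t := min (r m p) t) (le_min (hr0 m p) ht.1)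
      ((min_le_right _ _).trans ht.2) ((min_le_left _ _).trans (min_le_right _ _))
    have h2 := (inc_bd hT (hr0 m p) (hrn m p) t ht).2.1
    have e : Sm T hT m (min (r m p) t) p.1 = DD hT m (min (r m p) t) p +
      (SSbarProc T hT (min (r m p) t) p - SSbarProc T hT 0 p) := by unfold DD; ring
    rw [e]
    exact (abs_add_le _ _).trans (add_le_add h1 h2)
  have hM1 : ∀ m, Mart P (FbarRaw T) T (fun t p => Sm T hT m (min (r m p) t) p.1) := by
    intro m
    refine Mart.lim (X := fun K t p => PS hT m K (min (r m p) t) p.1) (C := 1 + ((n:ℝ) ^ 2 + n))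
      (fun K => PS_mart hT m hS (hr m) (hr0 m) (hrn m) K) (fun K t ht => ae_of_all _ fun p => ?_)
      (fun t ht => ae_of_all _ fun p => ?_)
    · rw [PS_eq, min_left_comm]
      exact hbd m p _ ⟨le_min (sig_nonneg hT m _ _) ht.1, (min_le_right _ _).trans ht.2⟩
    · obtain ⟨K0, hK0⟩ := sig_eventually hT m p.1
      refine tendsto_const_nhds.congr' ?_
      filter_upwards [eventually_ge_atTop K0] with K hK
      exact Sm_eq_PS hT m (fun k hk => hK0 k (hK.trans hk)) _
  refine Mart.lim hM1 (fun m t ht => ae_of_all _ fun p => hbd m p t ht) fun t ht => ?_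
  filter_upwards [hg] with p hp
  have hu : min (rho hT n p) t ∈ Icc (0:ℝ) T := ⟨le_min (rho_nonneg hT n p) ht.1, (min_le_right _ _).trans ht.2⟩
  rw [Metric.tendsto_nhds]
  intro ε hε
  filter_upwards [hp.2 ε hε, hp.2 1 one_pos] with m h1 h2
  have hk : kap hT m 1 p = T + 1 := hit_gt (Y := DA hT m) (by linarith) ((DA_CA hT m).cont p)
    fun t h0 h1 => h2 t ⟨h0, h1⟩
  have e : min (r m p) t = min (rho hT n p) t := by
    show min (min (rho hT n p) (kap hT m 1 p)) t = _
    rw [hk, min_assoc, min_eq_right (show t ≤ T + 1 by linarith [ht.2])]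
  rw [e]
  have := h1 _ hu
  rw [DD, hp.1, sub_zero] at this
  exact this

theorem dir1 {Xibar : Set (PathPair T)}
    (hQ : Q ∈ MSet T hT {ω ∈ BigOmega T hT | (ω, qv T hT ω) ∈ Xibar}) :
    Q.map (psiMap T hT) ∈ MbarSet T hT Xibar := by
  obtain ⟨-, hS, hX⟩ := hQ
  have hO : ∀ᵐ ω ∂Q, ω ∈ BigOmega T hT := ae_of_mass hX (BigOmega_meas hT) fun ω h => h.1
  have hp := (psi_meas hT).aemeasurable (μ := Q)
  haveI hP : IsProbabilityMeasure (Q.map (psiMap T hT)) := Measure.isProbabilityMeasure_map hp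
  have hS' : LocMart (Q.map (psiMap T hT)) (FbarRaw T) T (SbarProc T hT) := by
    obtain ⟨τ, h1, h2, h3⟩ := hS
    refine ⟨fun m p => τ m p.1, fun m => Stop.lift (h1 m), ?_, fun m => ?_⟩
    · rw [← fst_psi hT (Q := Q)] at h2
      exact ae_of_ae_map measurable_fst.aemeasurable h2
    · exact lift_mart hT hO (X := fun t ω => ev T hT ω (min (τ m ω) t))
        (fun t ht => (stopped_meas Fraw_mono (ev_CA hT) ht (h1 m)).mono (Fraw_le t) le_rfl) (h3 m)
  have hg : ∀ᵐ p ∂(Q.map (psiMap T hT)), p.1 ∈ BigOmega T hT ∧ p.2 = qv T hT p.1 := by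
    refine (ae_map_iff hp ?_).2 (hO.mono fun ω h => ⟨h, rfl⟩)
    exact (measurable_fst (BigOmega_meas hT)).inter
      (measurableSet_eq_fun measurable_snd ((qv_meas hT).comp measurable_fst))
  refine ⟨hP, hS', I_locmart hT hS' (hg.mono fun p h => good_of_psi hT h.1 h.2), ?_⟩
  refine le_antisymm prob_le_one (le_trans ?_ (Measure.le_map_apply hp _))
  rw [← hX]
  exact measure_mono fun ω h => h.2

lemma erealPos_meas : Measurable erealPos := by
  unfold erealPos
  exact Measurable.ite (measurableSet_singleton _) measurable_const
    (measurable_ereal_toReal.ennreal_ofReal)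

lemma exp_map {P : Measure (PathPair T)} {ξ : Path T → EReal} (hm : Measurable ξ) :
    expEReal (P.map Prod.fst) ξ = expEReal P (fun p : PathPair T => ξ p.1) := by
  unfold expEReal
  rw [lintegral_map (f := fun x => erealPos (ξ x)) (erealPos_meas.comp hm) measurable_fst,
    lintegral_map (f := fun x => erealPos (-ξ x))
      (erealPos_meas.comp (continuous_neg.measurable.comp hm)) measurable_fst]

end dirone

/-- Main -/
theorem dual_transfer' (T : ℝ) (hT : 0 ≤ T)
    (Ξ : Set (Path T)) (Xibar : Set (PathPair T))
    (hform : Ξ = {ω ∈ BigOmega T hT | (ω, qv T hT ω) ∈ Xibar})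
    (hA2 : ∀ p ∈ Xibar, p.2 (t0 T hT) = 0 ∧ Monotone p.2)
    (ξ : Path T → EReal) (hmeas : Measurable ξ)
    (hbelow : ∃ b : ℝ, ∀ ω, (b : EReal) ≤ ξ ω) :
    (⨆ Q ∈ MSet T hT Ξ, expEReal Q ξ) =
      ⨆ Q ∈ MbarSet T hT Xibar, expEReal Q (fun p : PathPair T => ξ p.1) := by
  subst hform
  apply le_antisymm
  · refine iSup₂_le fun Q hQ => ?_
    haveI := hQ.1
    refine le_trans (le_of_eq ?_) (le_iSup₂ (f := fun (Q : Measure (PathPair T)) (_ : Q ∈ MbarSet T hT Xibar) =>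
      expEReal Q (fun p : PathPair T => ξ p.1)) (Q.map (psiMap T hT)) (dir1 hT hQ))
    rw [← exp_map hmeas, fst_psi]
  · refine iSup₂_le fun Q hQ => ?_
    haveI := hQ.1
    refine le_trans (le_of_eq ?_) (le_iSup₂ (f := fun (Q : Measure (Path T)) (_ : Q ∈ MSet T hT _) =>
      expEReal Q ξ) (Q.map Prod.fst) (dir2 hT hA2 hQ))
    rw [exp_map hmeas]

end PathwiseSuperhedging

namespace PathwiseSuperhedging

/-- **Lemma 4.7 (dual transition).** If `Ξ̄` satisfies (A2) and
`Ξ = {ω ∈ Ω : (ω,⟨ω⟩) ∈ Ξ̄}`, then for every Borel `ξ : C[0,T] → (-∞,∞]` bounded from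
below, `sup_{Q ∈ M(Ξ)} E_Q[ξ] = sup_{Q̄ ∈ M̄(Ξ̄)} E_{Q̄}[ξ ∘ S̄]`. -/
theorem dual_transfer (T : ℝ) (hT : 0 ≤ T)
    (Ξ : Set (Path T)) (Xibar : Set (PathPair T))
    (hform : Ξ = {ω ∈ BigOmega T hT | (ω, qv T hT ω) ∈ Xibar})
    (hA2 : ∀ p ∈ Xibar, p.2 (t0 T hT) = 0 ∧ Monotone p.2)
    (ξ : Path T → EReal) (hmeas : Measurable ξ)
    (hbelow : ∃ b : ℝ, ∀ ω, (b : EReal) ≤ ξ ω) :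
    (⨆ Q ∈ MSet T hT Ξ, expEReal Q ξ) =
      ⨆ Q ∈ MbarSet T hT Xibar, expEReal Q (fun p : PathPair T => ξ p.1) := by
  exact dual_transfer' T hT Ξ Xibar hform hA2 ξ hmeas hbelow

end PathwiseSuperhedging
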